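/- arXiv:math/0602032 — 13 statements merged into one kernel-verified Lean document; each statement's English description precedes it below -/
import Mathlib

section
/- Every submodule of an H-Kronecker module M = (V, W, α) is subordinate to a tight submodule of M. -/
open TensorProduct Module

/-- `(V', W')` is a submodule of the `H`-Kronecker module `(V, W, α)`. -/
def KroneckerPair {k H V W : Type*} [Field k]
    [AddCommGroup H] [Module k H] [AddCommGroup V] [Module k V]
    [AddCommGroup W] [Module k W]
    (α : TensorProduct k V H →ₗ[k] W) (V' : Submodule k V) (W' : Submodule k W) : Prop :=
  ∀ v ∈ V', ∀ h : H, α (v ⊗ₜ[k] h) ∈ W'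

/-- The submodule `(V', W')` is subordinate to the submodule `(V'', W'')`. -/
def KroneckerSubordinate {k V W : Type*} [Field k]
    [AddCommGroup V] [Module k V] [AddCommGroup W] [Module k W]
    (V' : Submodule k V) (W' : Submodule k W)
    (V'' : Submodule k V) (W'' : Submodule k W) : Prop :=
  V' ≤ V'' ∧ W'' ≤ W'

/-- The submodule `(V', W')` of `(V, W, α)` is tight: the only submodule it is
subordinate to is itself. -/
def KroneckerTight {k H V W : Type*} [Field k]
    [AddCommGroup H] [Module k H] [AddCommGroup V] [Module k V]
    [AddCommGroup W] [Module k W]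
    (α : TensorProduct k V H →ₗ[k] W) (V' : Submodule k V) (W' : Submodule k W) : Prop :=
  ∀ V'' : Submodule k V, ∀ W'' : Submodule k W, KroneckerPair α V'' W'' →
    KroneckerSubordinate V' W' V'' W'' → V'' = V' ∧ W'' = W'

theorem subordinate_to_tight
    {k H V W : Type*} [Field k]
    [AddCommGroup H] [Module k H] [FiniteDimensional k H]
    [AddCommGroup V] [Module k V] [FiniteDimensional k V]
    [AddCommGroup W] [Module k W] [FiniteDimensional k W]
    (α : TensorProduct k V H →ₗ[k] W)
    (V' : Submodule k V) (W' : Submodule k W) (h : KroneckerPair α V' W') :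
    ∃ (V'' : Submodule k V) (W'' : Submodule k W),
      KroneckerPair α V'' W'' ∧ KroneckerSubordinate V' W' V'' W'' ∧
      KroneckerTight α V'' W'' := by
  let V₁ : Submodule k V := ⨅ x : H, W'.comap (α ∘ₗ (TensorProduct.mk k V H).flip x)
  have hV₁ : ∀ v, v ∈ V₁ ↔ ∀ x : H, α (v ⊗ₜ[k] x) ∈ W' := by
    intro v
    simp [V₁, Submodule.mem_iInf]
  let W₁ : Submodule k W := Submodule.span k {w | ∃ v ∈ V₁, ∃ x : H, α (v ⊗ₜ[k] x) = w}
  have hW₁ : W₁ ≤ W' := by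
    refine Submodule.span_le.2 ?_
    rintro _ ⟨v, hv, x, rfl⟩
    exact (hV₁ v).1 hv x
  refine ⟨V₁, W₁, fun v hv x => Submodule.subset_span ⟨v, hv, x, rfl⟩,
    ⟨fun v hv => (hV₁ v).2 (h v hv), hW₁⟩, ?_⟩
  intro V₂ W₂ hp hs
  refine ⟨le_antisymm (fun v hv => (hV₁ v).2 fun x => hW₁ (hs.2 (hp v hv x))) hs.1,
    le_antisymm hs.2 (Submodule.span_le.2 ?_)⟩
  rintro _ ⟨v, hv, x, rfl⟩
  exact hp v (hs.1 hv) x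
end

section
/- An H-Kronecker module M = (V, W, α) is semistable if and only if every nonzero tight submodule (V', W') of M satisfies dim V' · dim W ≤ dim V · dim W'. (That is, semistability may be checked on tight submodules only.) -/
open TensorProduct Module

/-- The `H`-Kronecker module `(V, W, α)` is semistable. -/
def KroneckerSemistable {k H V W : Type*} [Field k]
    [AddCommGroup H] [Module k H] [AddCommGroup V] [Module k V]
    [AddCommGroup W] [Module k W]
    (α : TensorProduct k V H →ₗ[k] W) : Prop :=
  ∀ V' : Submodule k V, ∀ W' : Submodule k W, KroneckerPair α V' W' →
    ¬(V' = ⊥ ∧ W' = ⊥) →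
    finrank k V' * finrank k W ≤ finrank k V * finrank k W'

theorem exists_tight_aux
    {k H V W : Type*} [Field k]
    [AddCommGroup H] [Module k H]
    [AddCommGroup V] [Module k V] [FiniteDimensional k V]
    [AddCommGroup W] [Module k W] [FiniteDimensional k W]
    (α : TensorProduct k V H →ₗ[k] W) (n : ℕ) :
    ∀ (V' : Submodule k V) (W' : Submodule k W), KroneckerPair α V' W' →
      finrank k W' + (finrank k V - finrank k V') = n →
      ∃ (V'' : Submodule k V) (W'' : Submodule k W), KroneckerPair α V'' W'' ∧
        KroneckerTight α V'' W'' ∧ V' ≤ V'' ∧ W'' ≤ W' := by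
  induction n using Nat.strong_induction_on with
  | _ n ih =>
    intro V' W' hp hn
    by_cases ht : KroneckerTight α V' W'
    · exact ⟨V', W', hp, ht, le_rfl, le_rfl⟩
    · unfold KroneckerTight at ht
      push Not at ht
      obtain ⟨V1, W1, hp1, ⟨hV, hW⟩, hne⟩ := ht
      have a1 := Submodule.finrank_mono hV
      have a2 := Submodule.finrank_mono hW
      have a3 := Submodule.finrank_le V1
      have hlt : finrank k W1 + (finrank k V - finrank k V1) < n := by
        by_contra hc
        have e1 : V1 = V' := (Submodule.eq_of_le_of_finrank_eq hV (by omega)).symm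
        have e2 : W1 = W' := Submodule.eq_of_le_of_finrank_eq hW (by omega)
        exact hne e1 e2
      obtain ⟨V2, W2, h1, h2, h3, h4⟩ := ih _ hlt V1 W1 hp1 rfl
      exact ⟨V2, W2, h1, h2, hV.trans h3, h4.trans hW⟩

theorem semistable_iff_tight
    {k H V W : Type*} [Field k]
    [AddCommGroup H] [Module k H] [FiniteDimensional k H]
    [AddCommGroup V] [Module k V] [FiniteDimensional k V]
    [AddCommGroup W] [Module k W] [FiniteDimensional k W]
    (α : TensorProduct k V H →ₗ[k] W) :
    KroneckerSemistable α ↔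
      ∀ V' : Submodule k V, ∀ W' : Submodule k W, KroneckerPair α V' W' →
        KroneckerTight α V' W' → ¬(V' = ⊥ ∧ W' = ⊥) →
        finrank k V' * finrank k W ≤ finrank k V * finrank k W' := by
  constructor
  · intro h V' W' hp _ hne
    exact h V' W' hp hne
  · intro h V' W' hp _
    obtain ⟨V2, W2, h1, h2, h3, h4⟩ := exists_tight_aux α _ V' W' hp rfl
    by_cases hz : V2 = ⊥ ∧ W2 = ⊥
    · have : V' = ⊥ := le_bot_iff.mp (hz.1 ▸ h3)
      subst this
      simp
    · calc finrank k V' * finrank k W ≤ finrank k V2 * finrank k W :=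
            Nat.mul_le_mul_right _ (Submodule.finrank_mono h3)
        _ ≤ finrank k V * finrank k W2 := h V2 W2 h1 h2 hz
        _ ≤ finrank k V * finrank k W' :=
            Nat.mul_le_mul_left _ (Submodule.finrank_mono h4)
end

section
/- Let M = (V, W, α) be an H-Kronecker module. Suppose there exist nonzero finite-dimensional k-vector spaces U₀ and U₁ and a k-linear map γ : U₁ → U₀ ⊗ H such that the induced linear map Hom_k(U₀, V) → Hom_k(U₁, W), sending f to the composite α ∘ (f ⊗ id_H) ∘ γ, is bijective. Then M is semistable. -/
open TensorProduct Module

/-- If a Kronecker module `M = (V, W, α)` inverts some map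
`γ : U₁ → U₀ ⊗ H` (with `U₀, U₁` nonzero finite-dimensional), i.e. the induced
map `Hom(U₀, V) → Hom(U₁, W), f ↦ α ∘ (f ⊗ id_H) ∘ γ` is bijective,
then `M` is semistable. -/
theorem semistable_of_inverted_map
    {k H V W U₀ U₁ : Type*} [Field k]
    [AddCommGroup H] [Module k H] [FiniteDimensional k H]
    [AddCommGroup V] [Module k V] [FiniteDimensional k V]
    [AddCommGroup W] [Module k W] [FiniteDimensional k W]
    [AddCommGroup U₀] [Module k U₀] [FiniteDimensional k U₀] [Nontrivial U₀]
    [AddCommGroup U₁] [Module k U₁] [FiniteDimensional k U₁] [Nontrivial U₁]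
    (α : TensorProduct k V H →ₗ[k] W)
    (γ : U₁ →ₗ[k] TensorProduct k U₀ H)
    (hbij : Function.Bijective
      (fun f : U₀ →ₗ[k] V =>
        (α ∘ₗ TensorProduct.map f (LinearMap.id : H →ₗ[k] H)) ∘ₗ γ)) :
    KroneckerSemistable α := by
  classical
  intro V' W' hp _
  let Φ : (U₀ →ₗ[k] V) →ₗ[k] (U₁ →ₗ[k] W) :=
    { toFun := fun f => (α ∘ₗ TensorProduct.map f (LinearMap.id : H →ₗ[k] H)) ∘ₗ γ
      map_add' := fun f g => by
        ext x
        simp [TensorProduct.map_add_left]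
      map_smul' := fun c f => by
        ext x
        simp [TensorProduct.map_smul_left] }
  have hΦ : Function.Bijective Φ := hbij
  have e1 : finrank k U₀ * finrank k V = finrank k U₁ * finrank k W := by
    have := (LinearEquiv.ofBijective Φ hΦ).finrank_eq
    rwa [Module.finrank_linearMap, Module.finrank_linearMap] at this
  have hmem : ∀ (g : U₀ →ₗ[k] V') (t : TensorProduct k U₀ H),
      α (TensorProduct.map (V'.subtype ∘ₗ g) (LinearMap.id : H →ₗ[k] H) t) ∈ W' := by
    intro g t
    induction t using TensorProduct.induction_on with
    | zero => simp
    | tmul x h => simpa using hp (g x) (g x).2 h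
    | add a b ha hb => rw [map_add, map_add]; exact W'.add_mem ha hb
  let Ψ : (U₀ →ₗ[k] V') →ₗ[k] (U₁ →ₗ[k] W') :=
    { toFun := fun g => (Φ (V'.subtype ∘ₗ g)).codRestrict W' (fun x => hmem g (γ x))
      map_add' := fun f g => by
        ext x
        simp [LinearMap.comp_add]
      map_smul' := fun c f => by
        ext x
        simp [LinearMap.comp_smul] }
  have hΨ : Function.Injective Ψ := by
    intro f g hfg
    have h1 : Φ (V'.subtype ∘ₗ f) = Φ (V'.subtype ∘ₗ g) := by
      ext x
      exact congrArg Subtype.val (LinearMap.congr_fun hfg x)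
    have h2 := hΦ.1 h1
    ext x
    exact LinearMap.congr_fun h2 x
  have e2 : finrank k U₀ * finrank k V' ≤ finrank k U₁ * finrank k W' := by
    have := LinearMap.finrank_le_finrank_of_injective hΨ
    rwa [Module.finrank_linearMap, Module.finrank_linearMap] at this
  have hpos : 0 < finrank k U₁ := Module.finrank_pos
  refine Nat.le_of_mul_le_mul_left ?_ hpos
  calc finrank k U₁ * (finrank k V' * finrank k W)
      = finrank k V' * (finrank k U₁ * finrank k W) := by ring
    _ = finrank k V * (finrank k U₀ * finrank k V') := by rw [← e1]; ring
    _ ≤ finrank k V * (finrank k U₁ * finrank k W') := Nat.mul_le_mul_left _ e2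
    _ = finrank k U₁ * (finrank k V * finrank k W') := by ring
end

section
/- For every α : V ⊗ H → W, every g₀ ∈ GL(V) and every g₁ ∈ GL(W), the determinantal theta function θ_γ satisfies the semi-invariance transformation law θ_γ(g₁ ∘ α ∘ (g₀⁻¹ ⊗ id_H)) = (det g₀)^{-u₀} · (det g₁)^{u₁} · θ_γ(α). In other words, θ_γ is a semi-invariant of weight χ_U(g₀, g₁) = (det g₀)^{-u₀}(det g₁)^{u₁} for the action of GL(V) × GL(W) on the representation space Hom(V ⊗ H, W). -/
open TensorProduct Module

section

variable {k : Type*} [Field k]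
variable {H : Type*} [AddCommGroup H] [Module k H] [FiniteDimensional k H]
variable {a b u₀ u₁ : ℕ}

/-- The induced linear map `Θ_α : Hom_k(U₀, V) → Hom_k(U₁, W)`,
sending `f` to `α ∘ (f ⊗ id_H) ∘ γ`, for `V = k^a`, `W = k^b`, `U₀ = k^{u₀}`,
`U₁ = k^{u₁}`. -/
noncomputable def inducedHom
    (γ : (Fin u₁ → k) →ₗ[k] TensorProduct k (Fin u₀ → k) H)
    (α : TensorProduct k (Fin a → k) H →ₗ[k] (Fin b → k)) :
    ((Fin u₀ → k) →ₗ[k] (Fin a → k)) →ₗ[k] ((Fin u₁ → k) →ₗ[k] (Fin b → k)) where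
  toFun f := (α ∘ₗ TensorProduct.map f (LinearMap.id : H →ₗ[k] H)) ∘ₗ γ
  map_add' f g := by
    simp [TensorProduct.map_add_left, LinearMap.comp_add, LinearMap.add_comp]
  map_smul' c f := by
    simp [TensorProduct.map_smul_left, LinearMap.comp_smul, LinearMap.smul_comp]

/-- The standard basis of `Hom_k(k^m, k^n)`, indexed by `Fin (n * m)`. -/
noncomputable def homBasis (m n : ℕ) :
    Basis (Fin (n * m)) k ((Fin m → k) →ₗ[k] (Fin n → k)) :=
  ((Matrix.stdBasis k (Fin n) (Fin m)).map
    (LinearMap.toMatrix (Pi.basisFun k (Fin m)) (Pi.basisFun k (Fin n))).symm).reindex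
    finProdFinEquiv

/-- The determinantal theta function `θ_γ(α)`: the determinant of the matrix of
`Θ_α : Hom_k(U₀, V) → Hom_k(U₁, W)` with respect to the standard bases,
using `u₀ · a = u₁ · b` to make the matrix square. -/
noncomputable def thetaGamma (hu : u₀ * a = u₁ * b)
    (γ : (Fin u₁ → k) →ₗ[k] TensorProduct k (Fin u₀ → k) H)
    (α : TensorProduct k (Fin a → k) H →ₗ[k] (Fin b → k)) : k :=
  Matrix.det
    ((LinearMap.toMatrix (homBasis u₀ a) (homBasis u₁ b) (inducedHom γ α)).submatrix
      id (Fin.cast (show b * u₁ = a * u₀ by rw [mul_comm b u₁, mul_comm a u₀, hu])))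

/-- Post-composition with `g`. -/
noncomputable def postComp (m n : ℕ) (g : (Fin n → k) →ₗ[k] (Fin n → k)) :
    ((Fin m → k) →ₗ[k] (Fin n → k)) →ₗ[k] ((Fin m → k) →ₗ[k] (Fin n → k)) where
  toFun f := g ∘ₗ f
  map_add' f h := by simp [LinearMap.comp_add]
  map_smul' c f := by simp [LinearMap.comp_smul]

theorem det_postComp (m n : ℕ) (g : (Fin n → k) →ₗ[k] (Fin n → k)) :
    (LinearMap.toMatrix (homBasis m n) (homBasis m n) (postComp m n g)).det
      = LinearMap.det g ^ m := by
  have key : LinearMap.toMatrix (homBasis m n) (homBasis m n) (postComp m n g) =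
      Matrix.reindex finProdFinEquiv finProdFinEquiv
        (Matrix.kronecker (LinearMap.toMatrix (Pi.basisFun k (Fin n)) (Pi.basisFun k (Fin n)) g)
          (1 : Matrix (Fin m) (Fin m) k)) := by
    ext p q
    obtain ⟨⟨i, j⟩, rfl⟩ := finProdFinEquiv.surjective p
    obtain ⟨⟨r, s⟩, rfl⟩ := finProdFinEquiv.surjective q
    have h1 : (homBasis m n : Basis _ k _) (finProdFinEquiv (r, s)) =
        (LinearMap.toMatrix (Pi.basisFun k (Fin m)) (Pi.basisFun k (Fin n))).symm
          (Matrix.single r s 1) := by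
      simp [homBasis, Matrix.stdBasis_eq_single]
    have h2 : ∀ f : (Fin m → k) →ₗ[k] (Fin n → k),
        (homBasis m n : Basis _ k _).repr f (finProdFinEquiv (i, j)) =
        LinearMap.toMatrix (Pi.basisFun k (Fin m)) (Pi.basisFun k (Fin n)) f i j := by
      intro f
      simp only [homBasis, Basis.repr_reindex_apply, Equiv.symm_apply_apply, Basis.map_repr,
        LinearEquiv.trans_apply, LinearEquiv.symm_symm]
      rfl
    rw [LinearMap.toMatrix_apply, h1, h2]
    have h3 : postComp m n g ((LinearMap.toMatrix (Pi.basisFun k (Fin m))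
        (Pi.basisFun k (Fin n))).symm (Matrix.single r s 1)) = g ∘ₗ
        ((LinearMap.toMatrix (Pi.basisFun k (Fin m))
        (Pi.basisFun k (Fin n))).symm (Matrix.single r s 1)) := rfl
    rw [h3, LinearMap.toMatrix_comp _ (Pi.basisFun k (Fin n)), LinearEquiv.apply_symm_apply]
    simp only [Matrix.reindex_apply, Matrix.submatrix_apply, Equiv.symm_apply_apply,
      Matrix.kronecker, Matrix.kroneckerMap_apply]
    by_cases h : j = s
    · subst h
      simp
    · rw [Matrix.mul_single_apply_of_ne _ _ _ _ _ h, Matrix.one_apply_ne h, mul_zero]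
  rw [key, Matrix.det_reindex_self, Matrix.kronecker, Matrix.det_kronecker, LinearMap.det_toMatrix]
  simp

/-- Semi-invariance transformation law for the determinantal theta function:
`θ_γ((g₀, g₁) · α) = (det g₀)^{-u₀} (det g₁)^{u₁} θ_γ(α)`, where
`(g₀, g₁) · α = g₁ ∘ α ∘ (g₀⁻¹ ⊗ id_H)`. -/
theorem thetaGamma_semi_invariant (hu : u₀ * a = u₁ * b)
    (γ : (Fin u₁ → k) →ₗ[k] TensorProduct k (Fin u₀ → k) H)
    (α : TensorProduct k (Fin a → k) H →ₗ[k] (Fin b → k))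
    (g₀ : (Fin a → k) ≃ₗ[k] (Fin a → k)) (g₁ : (Fin b → k) ≃ₗ[k] (Fin b → k)) :
    thetaGamma hu γ
        ((g₁ : (Fin b → k) →ₗ[k] (Fin b → k)) ∘ₗ α ∘ₗ
          TensorProduct.map (g₀.symm : (Fin a → k) →ₗ[k] (Fin a → k))
            (LinearMap.id : H →ₗ[k] H)) =
      (LinearMap.det (g₀ : (Fin a → k) →ₗ[k] (Fin a → k)))⁻¹ ^ u₀ *
        (LinearMap.det (g₁ : (Fin b → k) →ₗ[k] (Fin b → k))) ^ u₁ *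
        thetaGamma hu γ α := by
  have hn : b * u₁ = a * u₀ := by rw [mul_comm b u₁, mul_comm a u₀, hu]
  have hc : inducedHom γ ((g₁ : (Fin b → k) →ₗ[k] (Fin b → k)) ∘ₗ α ∘ₗ
          TensorProduct.map (g₀.symm : (Fin a → k) →ₗ[k] (Fin a → k))
            (LinearMap.id : H →ₗ[k] H)) =
      postComp u₁ b (g₁ : (Fin b → k) →ₗ[k] (Fin b → k)) ∘ₗ inducedHom γ α ∘ₗ
        postComp u₀ a (g₀.symm : (Fin a → k) →ₗ[k] (Fin a → k)) := by
    apply LinearMap.ext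
    intro f
    simp only [inducedHom, postComp, LinearMap.coe_mk, AddHom.coe_mk, LinearMap.comp_apply]
    rw [← LinearMap.id_comp (LinearMap.id : H →ₗ[k] H), TensorProduct.map_comp]
    simp only [LinearMap.comp_assoc, LinearMap.id_comp]
  have hd : LinearMap.det (g₀.symm : (Fin a → k) →ₗ[k] (Fin a → k)) =
      (LinearMap.det (g₀ : (Fin a → k) →ₗ[k] (Fin a → k)))⁻¹ := by
    apply eq_inv_of_mul_eq_one_left
    rw [← LinearMap.det_comp]
    simp
  unfold thetaGamma
  rw [hc, LinearMap.toMatrix_comp _ (homBasis u₁ b), LinearMap.toMatrix_comp _ (homBasis u₀ a)]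
  have e : ∀ (A : Matrix (Fin (b * u₁)) (Fin (b * u₁)) k)
      (B : Matrix (Fin (b * u₁)) (Fin (a * u₀)) k) (C : Matrix (Fin (a * u₀)) (Fin (a * u₀)) k),
      ((A * (B * C)).submatrix id (Fin.cast hn)).det =
        C.det * A.det * (B.submatrix id (Fin.cast hn)).det := by
    intro A B C
    have : (A * (B * C)).submatrix id (Fin.cast hn) =
        A * (B.submatrix id (finCongr hn) * C.submatrix (finCongr hn) (finCongr hn)) := by
      rw [Matrix.submatrix_mul_equiv]
      rfl
    rw [this, Matrix.det_mul, Matrix.det_mul, Matrix.det_submatrix_equiv_self]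
    change _ * ((B.submatrix id (Fin.cast hn)).det * _) = _
    ring
  rw [e, det_postComp, det_postComp, hd]

end
end

section
/- Assume k is algebraically closed. Let M = (V, W, α) be a stable H-Kronecker module and let (f, g) be an endomorphism of M, i.e. linear maps f : V → V and g : W → W with g ∘ α = α ∘ (f ⊗ id_H). Then there exists a scalar c ∈ k such that f = c · id_V and g = c · id_W. (Stable Kronecker modules are simple: their endomorphism algebra is k.) -/
open TensorProduct Module

/-- The `H`-Kronecker module `(V, W, α)` is stable: semistable, and the slope
inequality is strict for every nonzero proper submodule. -/
def KroneckerStable {k H V W : Type*} [Field k]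
    [AddCommGroup H] [Module k H] [AddCommGroup V] [Module k V]
    [AddCommGroup W] [Module k W]
    (α : TensorProduct k V H →ₗ[k] W) : Prop :=
  KroneckerSemistable α ∧
    ∀ V' : Submodule k V, ∀ W' : Submodule k W, KroneckerPair α V' W' →
      ¬(V' = ⊥ ∧ W' = ⊥) → ¬(V' = ⊤ ∧ W' = ⊤) →
      finrank k V' * finrank k W < finrank k V * finrank k W'

/-- Stable Kronecker modules are simple: over an algebraically closed field,
every endomorphism of a stable Kronecker module is a scalar. -/
theorem stable_endomorphism_is_scalar
    {k H V W : Type*} [Field k] [IsAlgClosed k]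
    [AddCommGroup H] [Module k H] [FiniteDimensional k H]
    [AddCommGroup V] [Module k V] [FiniteDimensional k V]
    [AddCommGroup W] [Module k W] [FiniteDimensional k W]
    (α : TensorProduct k V H →ₗ[k] W) (hst : KroneckerStable α)
    (f : V →ₗ[k] V) (g : W →ₗ[k] W)
    (hcomm : g ∘ₗ α = α ∘ₗ TensorProduct.map f (LinearMap.id : H →ₗ[k] H)) :
    ∃ c : k, f = c • (LinearMap.id : V →ₗ[k] V) ∧
      g = c • (LinearMap.id : W →ₗ[k] W) := by
  have key : ∀ c : k, ¬(LinearMap.ker (f - c • (LinearMap.id : V →ₗ[k] V)) = ⊥ ∧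
      LinearMap.ker (g - c • (LinearMap.id : W →ₗ[k] W)) = ⊥) →
      f = c • (LinearMap.id : V →ₗ[k] V) ∧ g = c • (LinearMap.id : W →ₗ[k] W) := by
    intro c hne
    have hc : ∀ v h, (g - c • (LinearMap.id : W →ₗ[k] W)) (α (v ⊗ₜ[k] h)) =
        α ((f - c • (LinearMap.id : V →ₗ[k] V)) v ⊗ₜ[k] h) := by
      intro v h
      have := LinearMap.congr_fun hcomm (v ⊗ₜ[k] h)
      simp only [LinearMap.comp_apply, TensorProduct.map_tmul, LinearMap.id_apply] at this
      simp [this, TensorProduct.sub_tmul]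
      rw [← map_smul, TensorProduct.smul_tmul']
    rw [← sub_eq_zero, ← sub_eq_zero (a := g)]
    generalize f - c • (LinearMap.id : V →ₗ[k] V) = F at *
    generalize g - c • (LinearMap.id : W →ₗ[k] W) = G at *
    by_contra hcon
    have h1 := hst.2 (LinearMap.ker F) (LinearMap.ker G) (by
      intro v hv h
      rw [LinearMap.mem_ker] at hv ⊢
      rw [hc, hv, TensorProduct.zero_tmul, map_zero]) hne (by
      rwa [LinearMap.ker_eq_top, LinearMap.ker_eq_top])
    have h2 := hst.2 (LinearMap.range F) (LinearMap.range G) (by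
      rintro _ ⟨v, rfl⟩ h
      exact ⟨_, hc v h⟩) (by
      rwa [LinearMap.range_eq_bot, LinearMap.range_eq_bot]) (by
      rwa [← LinearMap.ker_eq_bot_iff_range_eq_top, ← LinearMap.ker_eq_bot_iff_range_eq_top])
    have h3 := F.finrank_range_add_finrank_ker
    have h4 := G.finrank_range_add_finrank_ker
    nlinarith
  rcases subsingleton_or_nontrivial V with hV | hV
  · rcases subsingleton_or_nontrivial W with hW | hW
    · exact ⟨0, Subsingleton.elim _ _, Subsingleton.elim _ _⟩
    · obtain ⟨c, h⟩ := Module.End.exists_eigenvalue g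
      obtain ⟨w, hw⟩ := h.exists_hasEigenvector
      refine ⟨c, key c fun hb => hw.2 ?_⟩
      rw [← Submodule.mem_bot k, ← hb.2]
      simp [hw.apply_eq_smul]
  · obtain ⟨c, h⟩ := Module.End.exists_eigenvalue f
    obtain ⟨w, hw⟩ := h.exists_hasEigenvector
    refine ⟨c, key c fun hb => hw.2 ?_⟩
    rw [← Submodule.mem_bot k, ← hb.1]
    simp [hw.apply_eq_smul]
end

section
/- Let M = (V, W, α) and N = (V̄, W̄, ᾱ) be stable H-Kronecker modules of the same slope, i.e. dim V · dim W̄ = dim V̄ · dim W. Then every nonzero homomorphism (f, g) : M → N (meaning f ≠ 0 or g ≠ 0) is an isomorphism: both f and g are bijective. -/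
open TensorProduct Module

/-- A nonzero homomorphism between stable Kronecker modules of the same slope
is an isomorphism. -/
theorem hom_between_stables_is_iso
    {k H V W V' W' : Type*} [Field k]
    [AddCommGroup H] [Module k H] [FiniteDimensional k H]
    [AddCommGroup V] [Module k V] [FiniteDimensional k V]
    [AddCommGroup W] [Module k W] [FiniteDimensional k W]
    [AddCommGroup V'] [Module k V'] [FiniteDimensional k V']
    [AddCommGroup W'] [Module k W'] [FiniteDimensional k W']
    (α : TensorProduct k V H →ₗ[k] W) (β : TensorProduct k V' H →ₗ[k] W')
    (hα : KroneckerStable α) (hβ : KroneckerStable β)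
    (hslope : finrank k V * finrank k W' = finrank k V' * finrank k W)
    (f : V →ₗ[k] V') (g : W →ₗ[k] W')
    (hcomm : g ∘ₗ α = β ∘ₗ TensorProduct.map f (LinearMap.id : H →ₗ[k] H))
    (hnz : f ≠ 0 ∨ g ≠ 0) :
    Function.Bijective f ∧ Function.Bijective g := by
  have hc : ∀ v h, g (α (v ⊗ₜ[k] h)) = β (f v ⊗ₜ[k] h) := by
    intro v h
    have := LinearMap.congr_fun hcomm (v ⊗ₜ[k] h)
    simpa using this
  have hker : KroneckerPair α (LinearMap.ker f) (LinearMap.ker g) := by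
    intro v hv h
    rw [LinearMap.mem_ker] at hv ⊢
    rw [hc, hv, TensorProduct.zero_tmul, map_zero]
  have him : KroneckerPair β (LinearMap.range f) (LinearMap.range g) := by
    rintro _ ⟨v, rfl⟩ h
    exact ⟨α (v ⊗ₜ[k] h), hc v h⟩
  have hkt : ¬(LinearMap.ker f = ⊤ ∧ LinearMap.ker g = ⊤) := by
    rw [LinearMap.ker_eq_top, LinearMap.ker_eq_top]
    tauto
  have hib : ¬(LinearMap.range f = ⊥ ∧ LinearMap.range g = ⊥) := by
    rw [LinearMap.range_eq_bot, LinearMap.range_eq_bot]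
    tauto
  have rf := LinearMap.finrank_range_add_finrank_ker f
  have rg := LinearMap.finrank_range_add_finrank_ker g
  have hle := Submodule.finrank_le (LinearMap.range f)
  have hss := hβ.1 _ _ him hib
  have hk0 : LinearMap.ker f = ⊥ ∧ LinearMap.ker g = ⊥ := by
    by_contra hk
    have hs := hα.2 _ _ hker hk hkt
    generalize finrank k (LinearMap.ker f) = K at *
    generalize finrank k (LinearMap.ker g) = L at *
    generalize finrank k (LinearMap.range f) = I at *
    generalize finrank k (LinearMap.range g) = J at *
    generalize finrank k V = v at *
    generalize finrank k W = w at *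
    generalize finrank k V' = v' at *
    generalize finrank k W' = w' at *
    have h1 : v * J < I * w := by
      have e1 : I * w + K * w = v * w := by rw [← add_mul, rf]
      have e2 : v * J + v * L = v * w := by rw [← mul_add, rg]
      omega
    have hI : 0 < I := by
      rcases Nat.eq_zero_or_pos I with h | h
      · simp [h] at h1
      · exact h
    have hv' : 0 < v' := lt_of_lt_of_le hI hle
    have h2 := Nat.mul_lt_mul_of_pos_left h1 hv'
    have h3 := Nat.mul_le_mul_left v hss
    have h4 : v * (I * w') = v' * (I * w) := by
      calc v * (I * w') = I * (v * w') := by ring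
        _ = v' * (I * w) := by rw [hslope]; ring
    have h5 : v * (v' * J) = v' * (v * J) := by ring
    omega
  have hit : LinearMap.range f = ⊤ ∧ LinearMap.range g = ⊤ := by
    by_contra hi
    have hs := hβ.2 _ _ him hib hi
    rw [hk0.1, finrank_bot, add_zero] at rf
    rw [hk0.2, finrank_bot, add_zero] at rg
    rw [rf, rg] at hs
    omega
  exact ⟨⟨LinearMap.ker_eq_bot.1 hk0.1, LinearMap.range_eq_top.1 hit.1⟩,
    ⟨LinearMap.ker_eq_bot.1 hk0.2, LinearMap.range_eq_top.1 hit.2⟩⟩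
end

section
/- Let M = (V, W, α) and N = (V̄, W̄, ᾱ) be semistable H-Kronecker modules of the same slope, i.e. dim V · dim W̄ = dim V̄ · dim W. Then the direct sum M ⊕ N = (V ⊕ V̄, W ⊕ W̄, α ⊕ ᾱ) is a semistable Kronecker module. -/
open TensorProduct Module

/-- The direct sum `(V ⊕ V̄, W ⊕ W̄, α ⊕ ᾱ)` of two `H`-Kronecker modules:
`(α ⊕ ᾱ)((v, v̄) ⊗ h) = (α(v ⊗ h), ᾱ(v̄ ⊗ h))`. -/
noncomputable def kroneckerDirectSum {k H V W V' W' : Type*} [Field k]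
    [AddCommGroup H] [Module k H] [AddCommGroup V] [Module k V]
    [AddCommGroup W] [Module k W] [AddCommGroup V'] [Module k V']
    [AddCommGroup W'] [Module k W']
    (α : TensorProduct k V H →ₗ[k] W) (β : TensorProduct k V' H →ₗ[k] W') :
    TensorProduct k (V × V') H →ₗ[k] (W × W') :=
  LinearMap.prod
    (α ∘ₗ TensorProduct.map (LinearMap.fst k V V') (LinearMap.id : H →ₗ[k] H))
    (β ∘ₗ TensorProduct.map (LinearMap.snd k V V') (LinearMap.id : H →ₗ[k] H))

theorem aux_finrank {k A B : Type*} [Field k] [AddCommGroup A] [Module k A]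
    [FiniteDimensional k A] [AddCommGroup B] [Module k B] [FiniteDimensional k B]
    (U : Submodule k (A × B)) :
    finrank k U = finrank k (U.comap (LinearMap.inl k A B))
      + finrank k (U.map (LinearMap.snd k A B)) := by
  have h := LinearMap.finrank_range_add_finrank_ker ((LinearMap.snd k A B).domRestrict U)
  have h1 : LinearMap.range ((LinearMap.snd k A B).domRestrict U)
      = U.map (LinearMap.snd k A B) := by
    rw [LinearMap.range_domRestrict]
  have e : (U.comap (LinearMap.inl k A B)) ≃ₗ[k]
      LinearMap.ker ((LinearMap.snd k A B).domRestrict U) :=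
    { toFun := fun a => ⟨⟨(a.1, 0), a.2⟩, by simp⟩
      invFun := fun x => ⟨x.1.1.1, by
        obtain ⟨⟨⟨a, b⟩, hu⟩, hx⟩ := x
        have hb : b = 0 := by simpa using hx
        subst hb
        exact hu⟩
      map_add' := fun a b => by ext <;> simp
      map_smul' := fun c a => by ext <;> simp
      left_inv := fun a => by ext; simp
      right_inv := fun x => by
        obtain ⟨⟨⟨a, b⟩, hu⟩, hx⟩ := x
        have hb : b = 0 := by simpa using hx
        subst hb
        rfl }
  rw [h1] at h
  rw [e.finrank_eq]
  omega

theorem aux_arith (p q r s v w v' w' : ℕ) (hp : p ≤ v) (hq : q ≤ v')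
    (h1 : p * w ≤ v * r) (h2 : q * w' ≤ v' * s) (h : v * w' = v' * w) :
    (p + q) * (w + w') ≤ (v + v') * (r + s) := by
  have a : p * w' ≤ v' * r := by
    rcases Nat.eq_zero_or_pos w with hw | hw
    · subst hw
      have : p * w' ≤ v * w' := Nat.mul_le_mul_right _ hp
      rw [h] at this
      simp at this
      rcases this with h | h <;> simp [h]
    · refine Nat.le_of_mul_le_mul_right (c := w) ?_ hw
      calc p * w' * w = p * w * w' := by ring
        _ ≤ v * r * w' := Nat.mul_le_mul_right _ h1
        _ = v * w' * r := by ring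
        _ = v' * r * w := by rw [h]; ring
  have b : q * w ≤ v * s := by
    rcases Nat.eq_zero_or_pos w' with hw | hw
    · subst hw
      have : q * w ≤ v' * w := Nat.mul_le_mul_right _ hq
      rw [← h] at this
      simp at this
      rcases this with h | h <;> simp [h]
    · refine Nat.le_of_mul_le_mul_right (c := w') ?_ hw
      calc q * w * w' = q * w' * w := by ring
        _ ≤ v' * s * w := Nat.mul_le_mul_right _ h2
        _ = v' * w * s := by ring
        _ = v * s * w' := by rw [← h]; ring
  nlinarith

theorem aux_ss {k H V W : Type*} [Field k]
    [AddCommGroup H] [Module k H] [AddCommGroup V] [Module k V]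
    [AddCommGroup W] [Module k W]
    (α : TensorProduct k V H →ₗ[k] W) (hα : KroneckerSemistable α)
    (V' : Submodule k V) (W' : Submodule k W) (h : KroneckerPair α V' W') :
    finrank k V' * finrank k W ≤ finrank k V * finrank k W' := by
  by_cases h0 : V' = ⊥ ∧ W' = ⊥
  · rw [h0.1]; simp
  · exact hα V' W' h h0

/-- The direct sum of two semistable Kronecker modules of the same slope is
semistable. -/
theorem directSum_semistable
    {k H V W V' W' : Type*} [Field k]
    [AddCommGroup H] [Module k H] [FiniteDimensional k H]
    [AddCommGroup V] [Module k V] [FiniteDimensional k V]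
    [AddCommGroup W] [Module k W] [FiniteDimensional k W]
    [AddCommGroup V'] [Module k V'] [FiniteDimensional k V']
    [AddCommGroup W'] [Module k W'] [FiniteDimensional k W']
    (α : TensorProduct k V H →ₗ[k] W) (β : TensorProduct k V' H →ₗ[k] W')
    (hα : KroneckerSemistable α) (hβ : KroneckerSemistable β)
    (hslope : finrank k V * finrank k W' = finrank k V' * finrank k W) :
    KroneckerSemistable (kroneckerDirectSum α β) := by
  intro U T hUT _
  rw [aux_finrank U, aux_finrank T, finrank_prod, finrank_prod]
  refine aux_arith _ _ _ _ _ _ _ _ (Submodule.finrank_le _) (Submodule.finrank_le _)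
    (aux_ss α hα _ _ ?_) (aux_ss β hβ _ _ ?_) hslope
  · intro v hv h
    have := hUT _ hv h
    simpa [kroneckerDirectSum] using this
  · rintro _ ⟨u, hu, rfl⟩ h
    exact ⟨_, hUT u hu h, by simp [kroneckerDirectSum]⟩
end

section
/- Let M = (V, W, α) be a semistable H-Kronecker module with V ≠ 0 and W ≠ 0, and let (V', W') be a nonzero submodule of the same slope as M, i.e. dim V' · dim W = dim V · dim W'. Then (V', W') is a tight submodule of M. -/
open TensorProduct Module

/-- In a semistable Kronecker module with `V ≠ 0` and `W ≠ 0`, every nonzero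
submodule of the same slope is tight. -/
theorem same_slope_submodule_tight
    {k H V W : Type*} [Field k]
    [AddCommGroup H] [Module k H] [FiniteDimensional k H]
    [AddCommGroup V] [Module k V] [FiniteDimensional k V] [Nontrivial V]
    [AddCommGroup W] [Module k W] [FiniteDimensional k W] [Nontrivial W]
    (α : TensorProduct k V H →ₗ[k] W) (hss : KroneckerSemistable α)
    (V' : Submodule k V) (W' : Submodule k W)
    (hpair : KroneckerPair α V' W') (hnz : ¬(V' = ⊥ ∧ W' = ⊥))
    (hslope : finrank k V' * finrank k W = finrank k V * finrank k W') :
    KroneckerTight α V' W' := by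
  intro V'' W'' hp hs
  obtain ⟨h1, h2⟩ := hs
  have hV : 0 < finrank k V := finrank_pos
  have hW : 0 < finrank k W := finrank_pos
  have key : finrank k V'' * finrank k W ≤ finrank k V * finrank k W'' := by
    by_cases h : V'' = ⊥ ∧ W'' = ⊥
    · obtain ⟨rfl, rfl⟩ := h
      simp
    · exact hss V'' W'' hp h
  have d1 : finrank k V' ≤ finrank k V'' := Submodule.finrank_mono h1
  have d2 : finrank k W'' ≤ finrank k W' := Submodule.finrank_mono h2
  have e1 : finrank k V'' ≤ finrank k V' := by
    refine Nat.le_of_mul_le_mul_right ?_ hW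
    exact key.trans ((Nat.mul_le_mul_left _ d2).trans hslope.ge)
  have e2 : finrank k W' ≤ finrank k W'' := by
    refine Nat.le_of_mul_le_mul_left ?_ hV
    exact hslope.ge.trans ((Nat.mul_le_mul_right _ d1).trans key)
  exact ⟨(Submodule.eq_of_le_of_finrank_le h1 e1).symm,
    Submodule.eq_of_le_of_finrank_le h2 e2⟩
end

section
/- Every nonzero semistable H-Kronecker module M = (V, W, α) admits an S-filtration: there exist k ≥ 1 and chains of subspaces 0 = V₀ ⊆ V₁ ⊆ ⋯ ⊆ V_k = V and 0 = W₀ ⊆ W₁ ⊆ ⋯ ⊆ W_k = W such that α(Vᵢ ⊗ H) ⊆ Wᵢ for each i, each inclusion is strict in the sense that (Vᵢ₋₁, Wᵢ₋₁) ≠ (Vᵢ, Wᵢ), and for each i the factor Kronecker module (Vᵢ/Vᵢ₋₁, Wᵢ/Wᵢ₋₁, ᾱᵢ), with ᾱᵢ induced by α, is stable of the same slope as M, i.e. dim(Vᵢ/Vᵢ₋₁) · dim W = dim V · dim(Wᵢ/Wᵢ₋₁). -/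
open TensorProduct Module

section Helpers
variable {k H V W : Type*} [Field k]
    [AddCommGroup H] [Module k H]
    [AddCommGroup V] [Module k V] [FiniteDimensional k V]
    [AddCommGroup W] [Module k W] [FiniteDimensional k W]

/-- The preimage in `V` of a subspace of the subquotient. -/
def SFlift (A A' : Submodule k V) (X : Submodule k (A' ⧸ Submodule.comap A'.subtype A)) :
    Submodule k V := (X.comap (Submodule.mkQ _)).map A'.subtype

theorem SFlift_le (A A' : Submodule k V)
    (X : Submodule k (A' ⧸ Submodule.comap A'.subtype A)) : SFlift A A' X ≤ A' :=
  Submodule.map_subtype_le _ _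

theorem le_SFlift {A A' : Submodule k V} (h : A ≤ A')
    (X : Submodule k (A' ⧸ Submodule.comap A'.subtype A)) : A ≤ SFlift A A' X := by
  intro x hx
  refine ⟨⟨x, h hx⟩, ?_, rfl⟩
  have : (Submodule.mkQ (Submodule.comap A'.subtype A)) ⟨x, h hx⟩ = 0 := by
    simpa using hx
  simp only [SetLike.mem_coe, Submodule.mem_comap, this, zero_mem]

theorem SFlift_bot {A A' : Submodule k V} (h : A ≤ A') : SFlift A A' ⊥ = A := by
  unfold SFlift
  rw [← LinearMap.ker, Submodule.ker_mkQ, Submodule.map_comap_subtype]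
  simpa using h

theorem finrank_comap_SF {A A' : Submodule k V} (h : A ≤ A') :
    finrank k (Submodule.comap A'.subtype A) = finrank k A :=
  (Submodule.comapSubtypeEquivOfLe h).finrank_eq

theorem finrank_SFlift {A A' : Submodule k V} (h : A ≤ A')
    (X : Submodule k (A' ⧸ Submodule.comap A'.subtype A)) :
    finrank k (SFlift A A' X) = finrank k X + finrank k A := by
  unfold SFlift
  rw [Submodule.finrank_map_subtype_eq, ← finrank_comap_SF h]
  set f := Submodule.mkQ (Submodule.comap A'.subtype A) with hf
  have h1 := LinearMap.finrank_range_add_finrank_ker (f.domRestrict (X.comap f))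
  have h2 : LinearMap.range (f.domRestrict (X.comap f)) = X := by
    rw [LinearMap.range_domRestrict, Submodule.map_comap_eq_of_surjective (Submodule.mkQ_surjective _)]
  have h3 : finrank k (LinearMap.ker (f.domRestrict (X.comap f)))
      = finrank k (Submodule.comap A'.subtype A) := by
    rw [LinearMap.ker_domRestrict]
    have : LinearMap.ker f = Submodule.comap A'.subtype A := Submodule.ker_mkQ _
    rw [this]
    refine (Submodule.comapSubtypeEquivOfLe ?_).finrank_eq
    exact this.symm.le.trans (LinearMap.ker_le_comap f)
  rw [h2, h3] at h1
  exact h1.symm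

theorem finrank_quot_SF {A A' : Submodule k V} (h : A ≤ A') :
    finrank k (A' ⧸ Submodule.comap A'.subtype A) + finrank k A = finrank k A' := by
  rw [← finrank_comap_SF h]
  exact Submodule.finrank_quotient_add_finrank _

/-- The statement about one step of the filtration. -/
def SFStep (α : TensorProduct k V H →ₗ[k] W) (A A' : Submodule k V) (B B' : Submodule k W) :
    Prop :=
  ∃ αbar : TensorProduct k (↥A' ⧸ Submodule.comap A'.subtype A) H →ₗ[k]
      (↥B' ⧸ Submodule.comap B'.subtype B),
    (∀ (v : A') (h : H) (w : B'), (w : W) = α ((v : V) ⊗ₜ[k] h) →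
      αbar ((Submodule.Quotient.mk v) ⊗ₜ[k] h) = Submodule.Quotient.mk w) ∧
    KroneckerStable αbar ∧
    finrank k (↥A' ⧸ Submodule.comap A'.subtype A) * finrank k W =
      finrank k V * finrank k (↥B' ⧸ Submodule.comap B'.subtype B)

theorem SF_exists_bar (α : TensorProduct k V H →ₗ[k] W) {A A' : Submodule k V}
    {B B' : Submodule k W} (hP : KroneckerPair α A B) (hP' : KroneckerPair α A' B') :
    ∃ αbar : TensorProduct k (↥A' ⧸ Submodule.comap A'.subtype A) H →ₗ[k]
      (↥B' ⧸ Submodule.comap B'.subtype B),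
    (∀ (v : A') (h : H) (w : B'), (w : W) = α ((v : V) ⊗ₜ[k] h) →
      αbar ((Submodule.Quotient.mk v) ⊗ₜ[k] h) = Submodule.Quotient.mk w) := by
  let β : A' →ₗ[k] H →ₗ[k] B' := LinearMap.mk₂ k
    (fun v h => ⟨α ((v : V) ⊗ₜ[k] h), hP' v v.2 h⟩)
    (fun a b c => by ext; simp [TensorProduct.add_tmul])
    (fun c a b => by ext; simp [← TensorProduct.smul_tmul'])
    (fun a b c => by ext; simp [TensorProduct.tmul_add])
    (fun c a b => by ext; simp)
  let γ := β.compr₂ (Submodule.mkQ (Submodule.comap B'.subtype B))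
  refine ⟨TensorProduct.lift (Submodule.liftQ _ γ ?_), ?_⟩
  · intro v hv
    rw [LinearMap.mem_ker]
    ext h
    have := hP v hv h
    simpa [γ, β] using this
  · intro v h w hw
    rw [TensorProduct.lift.tmul]
    change γ v h = _
    have : β v h = w := by ext; simp [β, hw]
    simp [γ, this]

theorem SF_arith_le {v w a b x y : ℕ} (hne : 0 < v ∨ 0 < w) (h : a * w = v * b)
    (hx : x ≤ a) (hle : x * w ≤ v * y) : x * b ≤ a * y := by
  rcases Nat.eq_zero_or_pos v with rfl | hv
  · have hw : 0 < w := by omega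
    have : a = 0 := by
      rw [zero_mul] at h
      exact (Nat.mul_eq_zero.1 h).resolve_right hw.ne'
    subst this
    have : x = 0 := by omega
    simp [this]
  · refine Nat.le_of_mul_le_mul_left ?_ hv
    calc v * (x * b) = x * (v * b) := by ring
      _ = a * (x * w) := by rw [← h]; ring
      _ ≤ a * (v * y) := Nat.mul_le_mul_left _ hle
      _ = v * (a * y) := by ring

theorem SF_arith_lt {v w a b x y : ℕ} (hab : 0 < a ∨ 0 < b) (h : a * w = v * b)
    (hlt : x * w < v * y) : x * b < a * y := by
  have hv : 0 < v := by
    rcases Nat.eq_zero_or_pos v with rfl | hv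
    · simp at hlt
    · exact hv
  have ha : 0 < a := by
    rcases Nat.eq_zero_or_pos a with rfl | ha
    · rw [zero_mul] at h
      have := (Nat.mul_eq_zero.1 h.symm)
      omega
    · exact ha
  refine Nat.lt_of_mul_lt_mul_left (a := v) ?_
  calc v * (x * b) = x * (v * b) := by ring
    _ = a * (x * w) := by rw [← h]; ring
    _ < a * (v * y) := Nat.mul_lt_mul_of_pos_left hlt ha
    _ = v * (a * y) := by ring

/-- A submodule of the same slope. -/
def SFGood (α : TensorProduct k V H →ₗ[k] W) (A : Submodule k V) (B : Submodule k W) : Prop :=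
  KroneckerPair α A B ∧ finrank k A * finrank k W = finrank k V * finrank k B

theorem SF_step (α : TensorProduct k V H →ₗ[k] W) (hss : KroneckerSemistable α)
    (hne : 0 < finrank k V ∨ 0 < finrank k W)
    {A A' : Submodule k V} {B B' : Submodule k W}
    (hG : SFGood α A B) (hG' : SFGood α A' B') (hA : A ≤ A') (hB : B ≤ B')
    (hn : ¬(A = A' ∧ B = B'))
    (hmin : ∀ (X : Submodule k V) (Y : Submodule k W), SFGood α X Y → A ≤ X → B ≤ Y →
      ¬(A = X ∧ B = Y) → finrank k A' + finrank k B' ≤ finrank k X + finrank k Y) :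
    SFStep α A A' B B' := by
  obtain ⟨αbar, hbar⟩ := SF_exists_bar α hG.1 hG'.1
  have dA := finrank_quot_SF hA
  have dB := finrank_quot_SF hB
  have hslope : finrank k (↥A' ⧸ Submodule.comap A'.subtype A) * finrank k W =
      finrank k V * finrank k (↥B' ⧸ Submodule.comap B'.subtype B) := by
    have h1 := hG.2
    have h2 := hG'.2
    rw [← dA, ← dB, add_mul, mul_add] at h2
    omega
  have hab : 0 < finrank k (↥A' ⧸ Submodule.comap A'.subtype A) ∨
      0 < finrank k (↥B' ⧸ Submodule.comap B'.subtype B) := by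
    by_contra hcon
    exact hn ⟨Submodule.eq_of_le_of_finrank_eq hA (by omega),
      Submodule.eq_of_le_of_finrank_eq hB (by omega)⟩
  have hpair : ∀ X Y, KroneckerPair αbar X Y →
      KroneckerPair α (SFlift A A' X) (SFlift B B' Y) := by
    rintro X Y hXY _ ⟨v, hv, rfl⟩ h
    have := hXY _ hv h
    refine ⟨⟨α ((v : V) ⊗ₜ[k] h), hG'.1 v v.2 h⟩, ?_, rfl⟩
    have h2 := hbar v h ⟨α ((v : V) ⊗ₜ[k] h), hG'.1 v v.2 h⟩ rfl
    rw [Submodule.mkQ_apply, h2] at this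
    exact this
  have hle : ∀ X Y, KroneckerPair αbar X Y →
      finrank k X * finrank k W ≤ finrank k V * finrank k Y := by
    intro X Y hXY
    have h1 : finrank k (SFlift A A' X) * finrank k W ≤
        finrank k V * finrank k (SFlift B B' Y) := by
      by_cases h0 : SFlift A A' X = ⊥ ∧ SFlift B B' Y = ⊥
      · rw [h0.1, h0.2]; simp
      · exact hss _ _ (hpair X Y hXY) h0
    rw [finrank_SFlift hA, finrank_SFlift hB, add_mul, mul_add] at h1
    have := hG.2
    omega
  refine ⟨αbar, hbar, ⟨fun X Y hXY _ => ?_, fun X Y hXY h0 h1 => ?_⟩, hslope⟩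
  · exact SF_arith_le hne hslope (Submodule.finrank_le X) (hle X Y hXY)
  · refine SF_arith_lt hab hslope (lt_of_le_of_ne (hle X Y hXY) fun heq => ?_)
    have fX := finrank_SFlift hA X
    have fY := finrank_SFlift hB Y
    have hgood : SFGood α (SFlift A A' X) (SFlift B B' Y) := by
      refine ⟨hpair X Y hXY, ?_⟩
      rw [fX, fY, add_mul, mul_add, heq, hG.2]
    have := hmin _ _ hgood (le_SFlift hA X) (le_SFlift hB Y) (by
      rintro ⟨e1, e2⟩
      rw [← e1] at fX
      rw [← e2] at fY
      exact h0 ⟨Submodule.finrank_eq_zero.1 (by omega), Submodule.finrank_eq_zero.1 (by omega)⟩)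
    have lX := Submodule.finrank_le X
    have lY := Submodule.finrank_le Y
    exact h1 ⟨Submodule.eq_top_of_finrank_eq (by omega), Submodule.eq_top_of_finrank_eq (by omega)⟩

theorem SF_next (α : TensorProduct k V H →ₗ[k] W) (hss : KroneckerSemistable α)
    (hne : 0 < finrank k V ∨ 0 < finrank k W)
    {A : Submodule k V} {B : Submodule k W}
    (hG : SFGood α A B) (hn : ¬(A = ⊤ ∧ B = ⊤)) :
    ∃ A' B', SFGood α A' B' ∧ A ≤ A' ∧ B ≤ B' ∧ ¬(A = A' ∧ B = B') ∧ SFStep α A A' B B' := by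
  classical
  have hex : ∃ n, ∃ A' B', SFGood α A' B' ∧ A ≤ A' ∧ B ≤ B' ∧ ¬(A = A' ∧ B = B') ∧
      finrank k A' + finrank k B' = n :=
    ⟨_, ⊤, ⊤, ⟨fun _ _ _ => trivial, by simp⟩, le_top, le_top, hn, rfl⟩
  obtain ⟨A', B', h1, h2, h3, h4, h5⟩ := Nat.find_spec hex
  refine ⟨A', B', h1, h2, h3, h4, SF_step α hss hne hG h1 h2 h3 h4 ?_⟩
  intro X Y hXY hX hY hne'
  rw [h5]
  exact Nat.find_min' hex ⟨X, Y, hXY, hX, hY, hne', rfl⟩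

theorem SF_chain (α : TensorProduct k V H →ₗ[k] W) (hss : KroneckerSemistable α)
    (hne : 0 < finrank k V ∨ 0 < finrank k W) (n : ℕ) :
    ∀ (A : Submodule k V) (B : Submodule k W), SFGood α A B →
      finrank k V + finrank k W ≤ finrank k A + finrank k B + n →
      ∃ (N : ℕ) (Vc : Fin (N + 1) → Submodule k V) (Wc : Fin (N + 1) → Submodule k W),
        Vc 0 = A ∧ Wc 0 = B ∧ Vc (Fin.last N) = ⊤ ∧ Wc (Fin.last N) = ⊤ ∧
        (∀ i, KroneckerPair α (Vc i) (Wc i)) ∧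
        (∀ i : Fin N, Vc i.castSucc ≤ Vc i.succ ∧ Wc i.castSucc ≤ Wc i.succ ∧
          ¬(Vc i.castSucc = Vc i.succ ∧ Wc i.castSucc = Wc i.succ) ∧
          SFStep α (Vc i.castSucc) (Vc i.succ) (Wc i.castSucc) (Wc i.succ)) := by
  induction n with
  | zero =>
    intro A B hG hle
    have lA := Submodule.finrank_le A
    have lB := Submodule.finrank_le B
    have tA : A = ⊤ := Submodule.eq_top_of_finrank_eq (by omega)
    have tB : B = ⊤ := Submodule.eq_top_of_finrank_eq (by omega)
    exact ⟨0, fun _ => A, fun _ => B, rfl, rfl, tA, tB, fun _ => hG.1, fun i => i.elim0⟩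
  | succ n ih =>
    intro A B hG hle
    by_cases hn : A = ⊤ ∧ B = ⊤
    · exact ⟨0, fun _ => A, fun _ => B, rfl, rfl, hn.1, hn.2, fun _ => hG.1, fun i => i.elim0⟩
    obtain ⟨A', B', hG', hA, hB, hd, hs⟩ := SF_next α hss hne hG hn
    have hlt : finrank k A + finrank k B < finrank k A' + finrank k B' := by
      have lA := Submodule.finrank_mono hA
      have lB := Submodule.finrank_mono hB
      by_contra hcon
      exact hd ⟨Submodule.eq_of_le_of_finrank_eq hA (by omega),
        Submodule.eq_of_le_of_finrank_eq hB (by omega)⟩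
    obtain ⟨N, Vc, Wc, hV0, hW0, hV1, hW1, hp, hst⟩ := ih A' B' hG' (by omega)
    refine ⟨N + 1, Fin.cons A Vc, Fin.cons B Wc, rfl, rfl, ?_, ?_, ?_, ?_⟩
    · rw [← Fin.succ_last, Fin.cons_succ, hV1]
    · rw [← Fin.succ_last, Fin.cons_succ, hW1]
    · intro i
      refine Fin.cases ?_ (fun j => ?_) i
      · exact hG.1
      · exact hp j
    · intro i
      refine Fin.cases ?_ (fun j => ?_) i
      · simp only [Fin.castSucc_zero, Fin.cons_zero, Fin.cons_succ, hV0, hW0]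
        exact ⟨hA, hB, hd, hs⟩
      · simp only [Fin.castSucc_succ, Fin.cons_succ]
        exact hst j

end Helpers

/-- Every nonzero semistable Kronecker module admits an S-filtration, i.e. a
filtration by submodules whose factors are stable of the same slope as `M`. -/
theorem exists_S_filtration
    {k H V W : Type*} [Field k]
    [AddCommGroup H] [Module k H] [FiniteDimensional k H]
    [AddCommGroup V] [Module k V] [FiniteDimensional k V]
    [AddCommGroup W] [Module k W] [FiniteDimensional k W]
    (α : TensorProduct k V H →ₗ[k] W) (hss : KroneckerSemistable α)
    (hnz : Nontrivial V ∨ Nontrivial W) :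
    ∃ (N : ℕ), 1 ≤ N ∧
      ∃ (Vc : Fin (N + 1) → Submodule k V) (Wc : Fin (N + 1) → Submodule k W),
        Monotone Vc ∧ Monotone Wc ∧
        Vc 0 = ⊥ ∧ Wc 0 = ⊥ ∧ Vc (Fin.last N) = ⊤ ∧ Wc (Fin.last N) = ⊤ ∧
        (∀ i, KroneckerPair α (Vc i) (Wc i)) ∧
        (∀ i : Fin N, ¬(Vc i.castSucc = Vc i.succ ∧ Wc i.castSucc = Wc i.succ)) ∧
        (∀ i : Fin N,
          ∃ αbar :
              TensorProduct k
                (↥(Vc i.succ) ⧸ Submodule.comap (Vc i.succ).subtype (Vc i.castSucc)) H →ₗ[k]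
              (↥(Wc i.succ) ⧸ Submodule.comap (Wc i.succ).subtype (Wc i.castSucc)),
            (∀ (v : Vc i.succ) (h : H) (w : Wc i.succ), (w : W) = α ((v : V) ⊗ₜ[k] h) →
              αbar ((Submodule.Quotient.mk v) ⊗ₜ[k] h) = Submodule.Quotient.mk w) ∧
            KroneckerStable αbar ∧
            finrank k
                (↥(Vc i.succ) ⧸ Submodule.comap (Vc i.succ).subtype (Vc i.castSucc)) *
              finrank k W =
            finrank k V *
              finrank k
                (↥(Wc i.succ) ⧸ Submodule.comap (Wc i.succ).subtype (Wc i.castSucc))) := by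
  have hne : 0 < finrank k V ∨ 0 < finrank k W := by
    rcases hnz with h | h
    · exact Or.inl Module.finrank_pos
    · exact Or.inr Module.finrank_pos
  obtain ⟨N, Vc, Wc, hV0, hW0, hV1, hW1, hp, hst⟩ :=
    SF_chain α hss hne (finrank k V + finrank k W) ⊥ ⊥
      ⟨fun v hv h => by
        rw [Submodule.mem_bot] at hv ⊢
        rw [hv, TensorProduct.zero_tmul, map_zero], by simp⟩ (by omega)
  refine ⟨N, ?_, Vc, Wc, Fin.monotone_iff_le_succ.2 fun i => (hst i).1,
    Fin.monotone_iff_le_succ.2 fun i => (hst i).2.1, hV0, hW0, hV1, hW1, hp,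
    fun i => (hst i).2.2.1, fun i => (hst i).2.2.2⟩
  rcases Nat.eq_zero_or_pos N with rfl | h
  · exfalso
    have e1 : (⊥ : Submodule k V) = ⊤ := hV0.symm.trans hV1
    have e2 : (⊥ : Submodule k W) = ⊤ := hW0.symm.trans hW1
    rcases hnz with h | h
    · exact bot_ne_top e1
    · exact bot_ne_top e2
  · exact h
end

section
/- Let M = (V, W, α) be a nonzero semistable H-Kronecker module, and let 0 = (V₀, W₀) ⊆ (V₁, W₁) ⊆ ⋯ ⊆ (V_k, W_k) = (V, W) and 0 = (V'₀, W'₀) ⊆ (V'₁, W'₁) ⊆ ⋯ ⊆ (V'_l, W'_l) = (V, W) be two S-filtrations of M. Then k = l and there is a permutation σ of {1, …, k} such that for each i the i-th factor (Vᵢ/Vᵢ₋₁, Wᵢ/Wᵢ₋₁, ᾱᵢ) of the first filtration is isomorphic, as an H-Kronecker module, to the σ(i)-th factor (V'_{σ(i)}/V'_{σ(i)-1}, W'_{σ(i)}/W'_{σ(i)-1}, ᾱ'_{σ(i)}) of the second. (Hence the associated graded module gr M is independent of the chosen S-filtration, up to isomorphism.) -/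
open TensorProduct Module

/-- An S-filtration of the semistable `H`-Kronecker module `(V, W, α)`:
an increasing chain of submodules, starting at `(0,0)` and ending at `(V,W)`,
with strict inclusions, together with the induced factor Kronecker modules,
each of which is stable of the same slope as `(V, W, α)`. -/
structure SFiltration {k H V W : Type*} [Field k]
    [AddCommGroup H] [Module k H] [AddCommGroup V] [Module k V]
    [AddCommGroup W] [Module k W]
    (α : TensorProduct k V H →ₗ[k] W) where
  n : ℕ
  npos : 0 < n
  Vc : Fin (n + 1) → Submodule k V
  Wc : Fin (n + 1) → Submodule k W
  vmono : Monotone Vc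
  wmono : Monotone Wc
  vbot : Vc 0 = ⊥
  wbot : Wc 0 = ⊥
  vtop : Vc (Fin.last n) = ⊤
  wtop : Wc (Fin.last n) = ⊤
  pair : ∀ i, KroneckerPair α (Vc i) (Wc i)
  strict : ∀ i : Fin n, ¬(Vc i.castSucc = Vc i.succ ∧ Wc i.castSucc = Wc i.succ)
  /-- The factor Kronecker module `(Vᵢ/Vᵢ₋₁, Wᵢ/Wᵢ₋₁, ᾱᵢ)`. -/
  fac : ∀ i : Fin n,
    TensorProduct k
        (↥(Vc i.succ) ⧸ Submodule.comap (Vc i.succ).subtype (Vc i.castSucc)) H →ₗ[k]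
      (↥(Wc i.succ) ⧸ Submodule.comap (Wc i.succ).subtype (Wc i.castSucc))
  compat : ∀ (i : Fin n) (v : Vc i.succ) (h : H) (w : Wc i.succ),
    (w : W) = α ((v : V) ⊗ₜ[k] h) →
    fac i ((Submodule.Quotient.mk v) ⊗ₜ[k] h) = Submodule.Quotient.mk w
  stable : ∀ i, KroneckerStable (fac i)
  slope : ∀ i : Fin n,
    finrank k (↥(Vc i.succ) ⧸ Submodule.comap (Vc i.succ).subtype (Vc i.castSucc)) *
        finrank k W =
      finrank k V *
        finrank k (↥(Wc i.succ) ⧸ Submodule.comap (Wc i.succ).subtype (Wc i.castSucc))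

lemma kr_finrank_quot {k V : Type*} [Field k] [AddCommGroup V] [Module k V]
    [FiniteDimensional k V] {A B : Submodule k V} (h : A ≤ B) :
    finrank k (↥B ⧸ Submodule.comap B.subtype A) + finrank k A = finrank k B := by
  rw [← (Submodule.comapSubtypeEquivOfLe h).finrank_eq]
  exact Submodule.finrank_quotient_add_finrank _

lemma kr_finrank_img {k V : Type*} [Field k] [AddCommGroup V] [Module k V]
    [FiniteDimensional k V] {A C B : Submodule k V} (h : A ≤ C) (h' : C ≤ B) :
    finrank k (Submodule.map (Submodule.comap B.subtype A).mkQ (Submodule.comap B.subtype C))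
      + finrank k A = finrank k C := by
  have h1 := Submodule.finrank_quotient_add_finrank
    (Submodule.map (Submodule.comap B.subtype A).mkQ (Submodule.comap B.subtype C))
  have h2 := (Submodule.quotientQuotientEquivQuotient (Submodule.comap B.subtype A)
    (Submodule.comap B.subtype C) (Submodule.comap_mono h)).finrank_eq
  have h3 := kr_finrank_quot h'
  have h4 := kr_finrank_quot (h.trans h')
  omega

lemma kr_second {k V : Type*} [Field k] [AddCommGroup V] [Module k V]
    (p p' s t : Submodule k V) (hs : s = p' ⊔ p) (ht : t = p' ⊓ p) :
    ∃ f : (↥p ⧸ Submodule.comap p.subtype t) ≃ₗ[k] (↥s ⧸ Submodule.comap s.subtype p'),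
      ∀ (v : p) (v' : s), (v : V) = v' →
        f (Submodule.Quotient.mk v) = Submodule.Quotient.mk v' := by
  rw [sup_comm] at hs
  subst hs
  have h : Submodule.comap p.subtype p ⊓ Submodule.comap p.subtype p'
      = Submodule.comap p.subtype t := by
    subst ht; ext; simp
  refine ⟨(Submodule.quotEquivOfEq _ _ h.symm).trans
    (LinearMap.quotientInfEquivSupQuotient p p'), ?_⟩
  intro v v' hv
  have : v' = Submodule.inclusion le_sup_left v := Subtype.ext hv.symm
  subst this
  rfl

section
variable {k H V W : Type*} [Field k]
    [AddCommGroup H] [Module k H] [AddCommGroup V] [Module k V] [FiniteDimensional k V]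
    [AddCommGroup W] [Module k W] [FiniteDimensional k W]

lemma kr_semi {α : TensorProduct k V H →ₗ[k] W} (hss : KroneckerSemistable α)
    {A : Submodule k V} {B : Submodule k W} (h : KroneckerPair α A B) :
    finrank k A * finrank k W ≤ finrank k V * finrank k B := by
  by_cases h0 : A = ⊥ ∧ B = ⊥
  · rw [h0.1, h0.2, finrank_bot, finrank_bot, zero_mul, mul_zero]
  · exact hss _ _ h h0

lemma kr_closed {α : TensorProduct k V H →ₗ[k] W} (hss : KroneckerSemistable α)
    {A A' : Submodule k V} {B B' : Submodule k W} (h : KroneckerPair α A B)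
    (h' : KroneckerPair α A' B')
    (e : finrank k A * finrank k W = finrank k V * finrank k B)
    (e' : finrank k A' * finrank k W = finrank k V * finrank k B') :
    (KroneckerPair α (A ⊔ A') (B ⊔ B') ∧
      finrank k ↥(A ⊔ A') * finrank k W = finrank k V * finrank k ↥(B ⊔ B')) ∧
    (KroneckerPair α (A ⊓ A') (B ⊓ B') ∧
      finrank k ↥(A ⊓ A') * finrank k W = finrank k V * finrank k ↥(B ⊓ B')) := by
  have p1 : KroneckerPair α (A ⊔ A') (B ⊔ B') := by
    intro v hv x
    obtain ⟨a, ha, b, hb, rfl⟩ := Submodule.mem_sup.1 hv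
    rw [TensorProduct.add_tmul, map_add]
    exact Submodule.add_mem_sup (h a ha x) (h' b hb x)
  have p2 : KroneckerPair α (A ⊓ A') (B ⊓ B') := fun v hv x =>
    ⟨h v hv.1 x, h' v hv.2 x⟩
  have i1 := kr_semi hss p1
  have i2 := kr_semi hss p2
  have d1 := Submodule.finrank_sup_add_finrank_inf_eq A A'
  have d2 := Submodule.finrank_sup_add_finrank_inf_eq B B'
  have d3 := congrArg (· * finrank k W) d1
  have d4 := congrArg (finrank k V * ·) d2
  simp only [add_mul, mul_add] at d3 d4
  refine ⟨⟨p1, by omega⟩, p2, by omega⟩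

/-- The lattice of submodules of the same slope. -/
def krLat (α : TensorProduct k V H →ₗ[k] W) (hss : KroneckerSemistable α) :
    Sublattice (Submodule k V × Submodule k W) where
  carrier := {p | KroneckerPair α p.1 p.2 ∧
    finrank k p.1 * finrank k W = finrank k V * finrank k p.2}
  supClosed' := fun _ hp _ hq => (kr_closed hss hp.1 hq.1 hp.2 hq.2).1
  infClosed' := fun _ hp _ hq => (kr_closed hss hp.1 hq.1 hp.2 hq.2).2

instance krLat_modular (α : TensorProduct k V H →ₗ[k] W) (hss : KroneckerSemistable α) :
    IsModularLattice (krLat α hss) where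
  sup_inf_le_assoc_of_le := by
    intro x y z hxz
    exact ⟨IsModularLattice.sup_inf_le_assoc_of_le y.1.1 (show x.1.1 ≤ z.1.1 from hxz.1),
      IsModularLattice.sup_inf_le_assoc_of_le y.1.2 (show x.1.2 ≤ z.1.2 from hxz.2)⟩

/-- Isomorphism of the factors. -/
def KrIso (α : TensorProduct k V H →ₗ[k] W) (p q : Submodule k V × Submodule k W)
    (p' q' : Submodule k V × Submodule k W) : Prop :=
  ∃ (f : (↥q.1 ⧸ Submodule.comap q.1.subtype p.1) ≃ₗ[k]
        (↥q'.1 ⧸ Submodule.comap q'.1.subtype p'.1))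
    (g : (↥q.2 ⧸ Submodule.comap q.2.subtype p.2) ≃ₗ[k]
        (↥q'.2 ⧸ Submodule.comap q'.2.subtype p'.2)),
    ∀ (v : q.1) (v' : q'.1) (h : H) (w : q.2) (w' : q'.2),
      (w : W) = α ((v : V) ⊗ₜ[k] h) → (w' : W) = α ((v' : V) ⊗ₜ[k] h) →
      f (Submodule.Quotient.mk v) = Submodule.Quotient.mk v' →
      g (Submodule.Quotient.mk w) = Submodule.Quotient.mk w'

set_option linter.unusedSectionVars false in
lemma kr_mk {α : TensorProduct k V H →ₗ[k] W} {p q : Submodule k V × Submodule k W}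
    (hp : KroneckerPair α p.1 p.2) (v v' : q.1) (h : H) (w w' : q.2)
    (hw : (w : W) = α ((v : V) ⊗ₜ[k] h)) (hw' : (w' : W) = α ((v' : V) ⊗ₜ[k] h))
    (e : (Submodule.Quotient.mk v : ↥q.1 ⧸ Submodule.comap q.1.subtype p.1)
      = Submodule.Quotient.mk v') :
    (Submodule.Quotient.mk w : ↥q.2 ⧸ Submodule.comap q.2.subtype p.2)
      = Submodule.Quotient.mk w' := by
  rw [Submodule.Quotient.eq] at e ⊢
  have := hp _ e h
  simp only [Submodule.mem_comap, Submodule.subtype_apply, Submodule.coe_sub] at this ⊢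
  rw [hw, hw', ← map_sub, ← TensorProduct.sub_tmul]
  exact this

lemma kr_iso_rel {α : TensorProduct k V H →ₗ[k] W} {hss : KroneckerSemistable α}
    {x y : krLat α hss × krLat α hss} (h : JordanHolderLattice.Iso x y) :
    KrIso α x.1.1 x.2.1 y.1.1 y.2.1 := by
  have symm : ∀ {x y : krLat α hss × krLat α hss}, KrIso α x.1.1 x.2.1 y.1.1 y.2.1 →
      KrIso α y.1.1 y.2.1 x.1.1 x.2.1 := by
    rintro x y ⟨f, g, h⟩
    refine ⟨f.symm, g.symm, fun v v' a w w' hw hw' e => ?_⟩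
    rw [LinearEquiv.symm_apply_eq] at e ⊢
    exact (h v' v a w' w hw' hw e.symm).symm
  refine JordanHolderLattice.Iso.rel
    (fun x y => KrIso α x.1.1 x.2.1 y.1.1 y.2.1) ?_ symm ?_ ?_ h
  · intro x
    exact ⟨LinearEquiv.refl _ _, LinearEquiv.refl _ _, fun v v' a w w' hw hw' e =>
      kr_mk x.1.2.1 v v' a w w' hw hw' e⟩
  · rintro x y z ⟨f, g, h⟩ ⟨f', g', h'⟩
    refine ⟨f.trans f', g.trans g', fun v v' a w w' hw hw' e => ?_⟩
    obtain ⟨u, hu⟩ := Submodule.Quotient.mk_surjective _ (f (Submodule.Quotient.mk v))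
    let t : y.2.1.2 := ⟨α ((u : V) ⊗ₜ[k] a), y.2.2.1 _ u.2 a⟩
    have h1 := h v u a w t hw rfl hu.symm
    have h2 := h' u v' a t w' rfl hw' (by rw [hu]; exact e)
    rw [LinearEquiv.trans_apply, h1, h2]
  · intro x y _
    apply symm (x := (x ⊓ y, y)) (y := (x, x ⊔ y))
    obtain ⟨f, hf⟩ := kr_second y.1.1 x.1.1 (x ⊔ y).1.1 (x ⊓ y).1.1 rfl rfl
    obtain ⟨g, hg⟩ := kr_second y.1.2 x.1.2 (x ⊔ y).1.2 (x ⊓ y).1.2 rfl rfl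
    refine ⟨f, g, fun v v' a w w' hw hw' e => ?_⟩
    have l : y.1 ≤ (x ⊔ y).1 := (le_sup_right : y ≤ x ⊔ y)
    have e1 := hf v ⟨v, l.1 v.2⟩ rfl
    have e2 := hg w ⟨w, l.2 w.2⟩ rfl
    refine e2.trans (kr_mk (q := (x ⊔ y).1) x.2.1 ⟨v, l.1 v.2⟩ v' a _ w' hw hw' (e1.symm.trans e))

lemma kr_slope {α : TensorProduct k V H →ₗ[k] W} (F : SFiltration α) (i : Fin (F.n + 1)) :
    finrank k (F.Vc i) * finrank k W = finrank k V * finrank k (F.Wc i) := by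
  induction i using Fin.induction with
  | zero => rw [F.vbot, F.wbot, finrank_bot, finrank_bot, zero_mul, mul_zero]
  | succ i ih =>
    have h1 := kr_finrank_quot (F.vmono (Fin.castSucc_le_succ i))
    have h2 := kr_finrank_quot (F.wmono (Fin.castSucc_le_succ i))
    rw [← h1, ← h2, add_mul, mul_add, ih, F.slope i]

/-- Filtration steps as elements of the lattice. -/
def krEl {α : TensorProduct k V H →ₗ[k] W} (hss : KroneckerSemistable α) (F : SFiltration α)
    (i : Fin (F.n + 1)) : krLat α hss := ⟨(F.Vc i, F.Wc i), F.pair i, kr_slope F i⟩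

lemma kr_covBy {α : TensorProduct k V H →ₗ[k] W} (hss : KroneckerSemistable α)
    (hnz : Nontrivial V ∨ Nontrivial W) (F : SFiltration α) (i : Fin F.n) :
    krEl hss F i.castSucc ⋖ krEl hss F i.succ := by
  have lV := F.vmono (Fin.castSucc_le_succ i)
  have lW := F.wmono (Fin.castSucc_le_succ i)
  refine ⟨lt_of_le_of_ne ⟨lV, lW⟩ ?_, ?_⟩
  · intro h
    exact F.strict i ⟨congrArg (fun x => x.1.1) h, congrArg (fun x => x.1.2) h⟩
  · rintro ⟨⟨A, B⟩, hp, hs⟩ h1 h2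
    have l1 : F.Vc i.castSucc ≤ A := h1.le.1
    have l2 : F.Wc i.castSucc ≤ B := h1.le.2
    have l3 : A ≤ F.Vc i.succ := h2.le.1
    have l4 : B ≤ F.Wc i.succ := h2.le.2
    have dA := kr_finrank_img l1 l3
    have dB := kr_finrank_img l2 l4
    have dV := kr_finrank_quot lV
    have dW := kr_finrank_quot lW
    have key := (F.stable i).2
      (Submodule.map (Submodule.comap (F.Vc i.succ).subtype (F.Vc i.castSucc)).mkQ
        (Submodule.comap (F.Vc i.succ).subtype A))
      (Submodule.map (Submodule.comap (F.Wc i.succ).subtype (F.Wc i.castSucc)).mkQ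
        (Submodule.comap (F.Wc i.succ).subtype B)) ?_ ?_ ?_
    · have s0 := kr_slope F i.castSucc
      have s1 := F.slope i
      simp only at hs
      rw [← dA, ← dB, add_mul, mul_add, s0] at hs
      have hs := Nat.add_right_cancel hs
      generalize finrank k (Submodule.map
        (Submodule.comap (F.Vc i.succ).subtype (F.Vc i.castSucc)).mkQ
        (Submodule.comap (F.Vc i.succ).subtype A)) = a at *
      generalize finrank k (Submodule.map
        (Submodule.comap (F.Wc i.succ).subtype (F.Wc i.castSucc)).mkQ
        (Submodule.comap (F.Wc i.succ).subtype B)) = b at *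
      generalize finrank k (↥(F.Vc i.succ) ⧸
        Submodule.comap (F.Vc i.succ).subtype (F.Vc i.castSucc)) = c at *
      generalize finrank k (↥(F.Wc i.succ) ⧸
        Submodule.comap (F.Wc i.succ).subtype (F.Wc i.castSucc)) = d at *
      apply key.ne
      rcases hnz with hV | hW
      · have : 0 < finrank k V := finrank_pos
        apply Nat.eq_of_mul_eq_mul_left this
        calc finrank k V * (a * d) = a * (finrank k V * d) := by ring
          _ = c * (a * finrank k W) := by rw [← s1]; ring
          _ = finrank k V * (c * b) := by rw [hs]; ring
      · have : 0 < finrank k W := finrank_pos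
        apply Nat.eq_of_mul_eq_mul_left this
        calc finrank k W * (a * d) = (a * finrank k W) * d := by ring
          _ = b * (finrank k V * d) := by rw [hs]; ring
          _ = finrank k W * (c * b) := by rw [← s1]; ring
    · rintro _ ⟨v, hv, rfl⟩ h
      refine ⟨⟨α ((v : V) ⊗ₜ[k] h), F.pair _ _ v.2 h⟩, hp _ hv h, ?_⟩
      exact (F.compat i v h _ rfl).symm
    · rintro ⟨e1, e2⟩
      rw [e1, finrank_bot, zero_add] at dA
      rw [e2, finrank_bot, zero_add] at dB
      have := Submodule.eq_of_le_of_finrank_eq l1 dA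
      have := Submodule.eq_of_le_of_finrank_eq l2 dB
      apply h1.ne
      apply Subtype.ext
      exact Prod.ext ‹_› ‹_›
    · rintro ⟨e1, e2⟩
      rw [e1, finrank_top] at dA
      rw [e2, finrank_top] at dB
      have := Submodule.eq_of_le_of_finrank_eq l3 (dA.symm.trans dV)
      have := Submodule.eq_of_le_of_finrank_eq l4 (dB.symm.trans dW)
      apply h2.ne
      apply Subtype.ext
      exact Prod.ext ‹_› ‹_›

/-- The composition series of an S-filtration. -/
def krSeries {α : TensorProduct k V H →ₗ[k] W} (hss : KroneckerSemistable α)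
    (hnz : Nontrivial V ∨ Nontrivial W) (F : SFiltration α) :
    CompositionSeries (krLat α hss) where
  length := F.n
  toFun := krEl hss F
  step := kr_covBy hss hnz F

end

/-- Any two S-filtrations of a nonzero semistable Kronecker module have the
same length, and their factors are isomorphic up to a permutation; hence the
associated graded module is independent of the S-filtration. -/
theorem sfiltration_factors_unique
    {k H V W : Type*} [Field k]
    [AddCommGroup H] [Module k H] [FiniteDimensional k H]
    [AddCommGroup V] [Module k V] [FiniteDimensional k V]
    [AddCommGroup W] [Module k W] [FiniteDimensional k W]
    (α : TensorProduct k V H →ₗ[k] W) (hss : KroneckerSemistable α)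
    (hnz : Nontrivial V ∨ Nontrivial W)
    (F1 F2 : SFiltration α) :
    F1.n = F2.n ∧
      ∃ σ : Fin F1.n ≃ Fin F2.n, ∀ i : Fin F1.n,
        ∃ (f : (↥(F1.Vc i.succ) ⧸
                 Submodule.comap (F1.Vc i.succ).subtype (F1.Vc i.castSucc)) ≃ₗ[k]
               (↥(F2.Vc (σ i).succ) ⧸
                 Submodule.comap (F2.Vc (σ i).succ).subtype (F2.Vc (σ i).castSucc)))
          (g : (↥(F1.Wc i.succ) ⧸
                 Submodule.comap (F1.Wc i.succ).subtype (F1.Wc i.castSucc)) ≃ₗ[k]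
               (↥(F2.Wc (σ i).succ) ⧸
                 Submodule.comap (F2.Wc (σ i).succ).subtype (F2.Wc (σ i).castSucc))),
          (g : _ →ₗ[k] _) ∘ₗ F1.fac i =
            F2.fac (σ i) ∘ₗ
              TensorProduct.map (f : _ →ₗ[k] _) (LinearMap.id : H →ₗ[k] H) := by
  obtain ⟨σ, hσ⟩ := CompositionSeries.jordan_holder (krSeries hss hnz F1) (krSeries hss hnz F2)
    (Subtype.ext (Prod.ext (F1.vbot.trans F2.vbot.symm) (F1.wbot.trans F2.wbot.symm)))
    (Subtype.ext (Prod.ext (F1.vtop.trans F2.vtop.symm) (F1.wtop.trans F2.wtop.symm)))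
  refine ⟨by simpa using Fintype.card_congr (show Fin F1.n ≃ Fin F2.n from σ), σ, fun i => ?_⟩
  obtain ⟨f, g, h⟩ := kr_iso_rel (hσ i)
  refine ⟨f, g, ?_⟩
  apply TensorProduct.ext'
  intro x a
  obtain ⟨v, rfl⟩ := Submodule.Quotient.mk_surjective _ x
  obtain ⟨u, hu⟩ := Submodule.Quotient.mk_surjective _ (f (Submodule.Quotient.mk v))
  have h1 := F1.compat i v a ⟨_, F1.pair _ _ v.2 a⟩ rfl
  have h2 := F2.compat (σ i) u a ⟨_, F2.pair _ _ u.2 a⟩ rfl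
  have h3 := h v u a ⟨_, F1.pair _ _ v.2 a⟩ ⟨_, F2.pair _ _ u.2 a⟩ rfl rfl hu.symm
  simp only [LinearMap.comp_apply, TensorProduct.map_tmul, LinearMap.id_apply]
  rw [h1]
  refine h3.trans (h2.symm.trans ?_)
  exact congrArg (fun z => F2.fac (σ i) (z ⊗ₜ[k] a)) hu
end

section
/- Let g : A₁ ⟶ A₂ be a local isomorphism of functors Sch^op → Set, let Y be a scheme, and let ψ₁ : A₁ ⟶ Hom_Sch(−, Y) be a natural transformation to the functor of points of Y. Then there exists a unique natural transformation ψ₂ : A₂ ⟶ Hom_Sch(−, Y) such that ψ₁ = ψ₂ ∘ g. -/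
open CategoryTheory AlgebraicGeometry Opposite

universe u

/-- A natural transformation `g : A₁ ⟶ A₂` between set-valued contravariant
functors on schemes is a local isomorphism if, Zariski-locally on any scheme,
it is injective and surjective: (1) elements of `A₁(S)` with the same image
agree on some open cover of `S`; and (2) any element of `A₂(S)` lifts to `A₁`
on some open cover of `S`. -/
def IsLocalIsomorphism {A₁ A₂ : Scheme.{u}ᵒᵖ ⥤ Type u} (g : A₁ ⟶ A₂) : Prop :=
  (∀ (S : Scheme.{u}) (a₁ a₂ : A₁.obj (op S)),
      g.app (op S) a₁ = g.app (op S) a₂ →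
      ∃ (ι : Type u) (T : ι → Scheme.{u}) (j : ∀ i, T i ⟶ S),
        (∀ i, IsOpenImmersion (j i)) ∧
        (∀ x : S, ∃ (i : ι) (y : T i), (j i).base y = x) ∧
        (∀ i, A₁.map (j i).op a₁ = A₁.map (j i).op a₂)) ∧
  (∀ (S : Scheme.{u}) (b : A₂.obj (op S)),
      ∃ (ι : Type u) (T : ι → Scheme.{u}) (j : ∀ i, T i ⟶ S),
        (∀ i, IsOpenImmersion (j i)) ∧
        (∀ x : S, ∃ (i : ι) (y : T i), (j i).base y = x) ∧
        (∀ i, ∃ a : A₁.obj (op (T i)), g.app (op (T i)) a = A₂.map (j i).op b))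

def ptsHom {A : Scheme.{u}ᵒᵖ ⥤ Type u} {Y : Scheme.{u}} (ψ : A ⟶ yoneda.obj Y)
    {S : Scheme.{u}} (a : A.obj (op S)) : S ⟶ Y := ψ.app (op S) a

lemma ptsHom_map {A : Scheme.{u}ᵒᵖ ⥤ Type u} {Y : Scheme.{u}} (ψ : A ⟶ yoneda.obj Y)
    {S T : Scheme.{u}} (h : T ⟶ S) (a : A.obj (op S)) :
    ptsHom ψ (A.map h.op a) = h ≫ ptsHom ψ a :=
  NatTrans.naturality_apply ψ h.op a

lemma exists_openCover {S : Scheme.{u}} {ι : Type u} (T : ι → Scheme.{u}) (j : ∀ i, T i ⟶ S)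
    (hj : ∀ i, IsOpenImmersion (j i))
    (hs : ∀ x : S, ∃ (i : ι) (y : T i), (j i).base y = x) (P : ∀ {U : Scheme.{u}}, (U ⟶ S) → Prop)
    (hP : ∀ i, P (j i)) : ∃ 𝒰 : Scheme.OpenCover.{u} S, ∀ i, P (𝒰.f i) :=
  ⟨Scheme.Cover.mkOfCovers ι T j hs hj, hP⟩

lemma ptsHom_eq {A₁ A₂ : Scheme.{u}ᵒᵖ ⥤ Type u} (g : A₁ ⟶ A₂)
    (hg : IsLocalIsomorphism g) {Y : Scheme.{u}} (ψ₁ : A₁ ⟶ yoneda.obj Y)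
    {S : Scheme.{u}} (a₁ a₂ : A₁.obj (op S)) (h : g.app (op S) a₁ = g.app (op S) a₂) :
    ptsHom ψ₁ a₁ = ptsHom ψ₁ a₂ := by
  obtain ⟨ι, T, j, hj, hs, he⟩ := hg.1 S a₁ a₂ h
  obtain ⟨𝒰, h𝒰⟩ := exists_openCover T j hj hs
    (fun f => A₁.map f.op a₁ = A₁.map f.op a₂) he
  refine 𝒰.hom_ext _ _ fun i => ?_
  rw [← ptsHom_map, ← ptsHom_map, h𝒰]

lemma ptsHom_eq' {A₁ A₂ : Scheme.{u}ᵒᵖ ⥤ Type u} (g : A₁ ⟶ A₂)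
    (hg : IsLocalIsomorphism g) {Y : Scheme.{u}} (ψ₁ : A₁ ⟶ yoneda.obj Y)
    {S T₁ T₂ P : Scheme.{u}} (b : A₂.obj (op S)) (h₁ : T₁ ⟶ S) (h₂ : T₂ ⟶ S)
    (a₁ : A₁.obj (op T₁)) (a₂ : A₁.obj (op T₂)) (e₁ : g.app (op T₁) a₁ = A₂.map h₁.op b)
    (e₂ : g.app (op T₂) a₂ = A₂.map h₂.op b) (p₁ : P ⟶ T₁) (p₂ : P ⟶ T₂)
    (w : p₁ ≫ h₁ = p₂ ≫ h₂) :
    p₁ ≫ ptsHom ψ₁ a₁ = p₂ ≫ ptsHom ψ₁ a₂ := by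
  rw [← ptsHom_map, ← ptsHom_map]
  apply ptsHom_eq g hg
  rw [NatTrans.naturality_apply, NatTrans.naturality_apply, e₁, e₂, ← Functor.map_comp_apply,
    ← Functor.map_comp_apply, ← op_comp, ← op_comp, w]

lemma existsUnique_ptsHom {A₁ A₂ : Scheme.{u}ᵒᵖ ⥤ Type u} (g : A₁ ⟶ A₂)
    (hg : IsLocalIsomorphism g) {Y : Scheme.{u}} (ψ₁ : A₁ ⟶ yoneda.obj Y)
    {S : Scheme.{u}} (b : A₂.obj (op S)) :
    ∃! f : S ⟶ Y, ∀ (T : Scheme.{u}) (h : T ⟶ S) (a : A₁.obj (op T)),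
      g.app (op T) a = A₂.map h.op b → ptsHom ψ₁ a = h ≫ f := by
  obtain ⟨ι, T, j, hj, hs, he⟩ := hg.2 S b
  obtain ⟨𝒰, h𝒰⟩ := exists_openCover T j hj hs
    (fun {U} f => ∃ a : A₁.obj (op U), g.app (op U) a = A₂.map f.op b) he
  choose a ha using h𝒰
  refine ⟨𝒰.glueMorphisms (fun i => ptsHom ψ₁ (a i)) fun i k =>
    ptsHom_eq' g hg ψ₁ b _ _ _ _ (ha i) (ha k) _ _ Limits.pullback.condition, ?_, ?_⟩
  · intro T h c hc
    refine Scheme.Cover.hom_ext (𝒰.pullback₁ h) _ _ fun (i : 𝒰.I₀) => ?_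
    have := ptsHom_eq' g hg ψ₁ b _ _ _ _ hc (ha i) (Limits.pullback.fst h (𝒰.f i))
      (Limits.pullback.snd h (𝒰.f i)) Limits.pullback.condition
    refine this.trans ?_
    change _ = Limits.pullback.fst h (𝒰.f i) ≫ _
    rw [Limits.pullback.condition_assoc, Scheme.Cover.ι_glueMorphisms]
  · intro f hf
    refine 𝒰.hom_ext _ _ fun i => ?_
    rw [Scheme.Cover.ι_glueMorphisms, hf _ _ _ (ha i)]

/-- A natural transformation to the functor of points of a scheme factors
uniquely through any local isomorphism. -/
theorem factor_through_local_isomorphism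
    {A₁ A₂ : Scheme.{u}ᵒᵖ ⥤ Type u} (g : A₁ ⟶ A₂)
    (hg : IsLocalIsomorphism g) (Y : Scheme.{u}) (ψ₁ : A₁ ⟶ yoneda.obj Y) :
    ∃! ψ₂ : A₂ ⟶ yoneda.obj Y, ψ₁ = g ≫ ψ₂ := by
  choose f hf hu using fun (S : Scheme.{u}) (b : A₂.obj (op S)) => existsUnique_ptsHom g hg ψ₁ b
  refine ⟨{ app := fun S => TypeCat.ofHom (fun b => f S.unop b), naturality := ?_ }, ?_, ?_⟩
  · intro S S' h
    ext b
    refine (hu S'.unop (A₂.map h b) (h.unop ≫ f S.unop b) ?_).symm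
    intro T k a ha
    rw [← Category.assoc]
    apply hf
    rw [ha, op_comp, Functor.map_comp_apply]
    rfl
  · ext S a
    refine (hf S.unop (g.app S a) _ (𝟙 _) a ?_).trans (Category.id_comp _)
    simp
  · intro ψ hψ
    ext S b
    refine hu S.unop b (ptsHom ψ b) ?_
    intro T h a ha
    rw [← ptsHom_map, ← ha, hψ]
    rfl
end

section
/- Let g : A₁ ⟶ A₂ be a local isomorphism of functors Sch^op → Set, let M₀ be a scheme, and let ψ₁ : A₁ ⟶ Hom_Sch(−, M₀) and ψ₂ : A₂ ⟶ Hom_Sch(−, M₀) be natural transformations with ψ₁ = ψ₂ ∘ g. Then ψ₁ corepresents A₁ if and only if ψ₂ corepresents A₂. -/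
open CategoryTheory AlgebraicGeometry Opposite

universe u

/-- A scheme `M₀`, via a natural transformation `ψ : M ⟶ Hom(−, M₀)`,
corepresents the functor `M` if every natural transformation from `M` to the
functor of points of a scheme factors uniquely through `ψ`. -/
def Corepresents {M : Scheme.{u}ᵒᵖ ⥤ Type u} {M₀ : Scheme.{u}}
    (ψ : M ⟶ yoneda.obj M₀) : Prop :=
  ∀ (Y : Scheme.{u}) (h : M ⟶ yoneda.obj Y),
    ∃! σ : M₀ ⟶ Y, h = ψ ≫ yoneda.map σ

theorem zar_mem {S : Scheme.{u}} {ι : Type u} (T : ι → Scheme.{u}) (j : ∀ i, T i ⟶ S)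
    (h1 : ∀ i, IsOpenImmersion (j i))
    (h2 : ∀ x : S, ∃ (i : ι) (y : T i), (j i).base y = x)
    (R : Sieve S) (hR : ∀ i, R (j i)) : R ∈ Scheme.zariskiTopology S := by
  refine GrothendieckTopology.superset_covering _ (S := Sieve.generate (.ofArrows T j)) ?_ ?_
  · rw [Sieve.generate_le_iff]
    rintro _ _ ⟨i⟩
    exact hR i
  · apply Precoverage.generate_mem_toGrothendieck
    rw [Scheme.ofArrows_mem_precoverage_iff]
    exact ⟨h2, h1⟩

theorem yon_sheaf (Y : Scheme.{u}) :
    Presieve.IsSheaf Scheme.zariskiTopology (yoneda.obj Y) :=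
  GrothendieckTopology.Subcanonical.isSheaf_of_isRepresentable _

theorem img_mem {A₁ A₂ : Scheme.{u}ᵒᵖ ⥤ Type u} {g : A₁ ⟶ A₂}
    (hg : IsLocalIsomorphism g) (S : Scheme.{u}) (b : A₂.obj (op S)) :
    Presheaf.imageSieve g b ∈ Scheme.zariskiTopology S := by
  obtain ⟨ι, T, j, h1, h2, h3⟩ := hg.2 S b
  exact zar_mem T j h1 h2 _ h3

theorem hom_ext_of_local {A₁ A₂ : Scheme.{u}ᵒᵖ ⥤ Type u} {g : A₁ ⟶ A₂}
    (hg : IsLocalIsomorphism g) (Y : Scheme.{u}) (k k' : A₂ ⟶ yoneda.obj Y)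
    (h : g ≫ k = g ≫ k') : k = k' := by
  ext ⟨S⟩ b
  refine ((yon_sheaf Y) _ (img_mem hg S b)).isSeparatedFor.ext ?_
  rintro V f ⟨a, ha⟩
  change (yoneda.obj Y).map f.op (k.app (op S) b) = (yoneda.obj Y).map f.op (k'.app (op S) b)
  rw [← NatTrans.naturality_apply, ← NatTrans.naturality_apply]
  have := ConcreteCategory.congr_hom (NatTrans.congr_app h (op V)) a
  simp only [NatTrans.comp_app, ConcreteCategory.comp_apply] at this
  erw [← ha]
  exact this

theorem eq_of_local {A₁ A₂ : Scheme.{u}ᵒᵖ ⥤ Type u} {g : A₁ ⟶ A₂}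
    (hg : IsLocalIsomorphism g) (Y : Scheme.{u}) (h : A₁ ⟶ yoneda.obj Y)
    (S : Scheme.{u}) (a a' : A₁.obj (op S)) (e : g.app _ a = g.app _ a') :
    h.app _ a = h.app _ a' := by
  obtain ⟨ι, T, j, h1, h2, h3⟩ := hg.1 S a a' e
  refine ((yon_sheaf Y) (Presheaf.equalizerSieve (F := A₁) a a')
    (zar_mem T j h1 h2 _ h3)).isSeparatedFor.ext ?_
  intro V f hf
  rw [← NatTrans.naturality_apply, ← NatTrans.naturality_apply]
  exact congrArg _ hf

theorem exists_section {A₁ A₂ : Scheme.{u}ᵒᵖ ⥤ Type u} {g : A₁ ⟶ A₂}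
    (hg : IsLocalIsomorphism g) (Y : Scheme.{u}) (h : A₁ ⟶ yoneda.obj Y)
    (S : Scheme.{u}) (b : A₂.obj (op S)) :
    ∃ t : (yoneda.obj Y).obj (op S), ∀ (V : Scheme.{u}) (f : V ⟶ S) (a : A₁.obj (op V)),
      g.app _ a = A₂.map f.op b → (yoneda.obj Y).map f.op t = h.app _ a := by
  let x : Presieve.FamilyOfElements (yoneda.obj Y) (Presheaf.imageSieve g b).arrows :=
    fun V f hf => h.app (op V) hf.choose
  have hx : x.Compatible := by
    rw [Presieve.compatible_iff_sieveCompatible]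
    intro V W f p hf
    change h.app _ _ = (yoneda.obj Y).map p.op (h.app _ _)
    rw [← NatTrans.naturality_apply]
    apply eq_of_local hg
    rw [NatTrans.naturality_apply]
    refine (Exists.choose_spec ((Presheaf.imageSieve g b).downward_closed hf p)).trans ?_
    rw [op_comp, A₂.map_comp, ConcreteCategory.comp_apply]
    exact congrArg _ (Exists.choose_spec hf).symm
  obtain ⟨t, ht, -⟩ := (yon_sheaf Y) _ (img_mem hg S b) x hx
  refine ⟨t, fun V f a ha => ?_⟩
  have hf : Presheaf.imageSieve g b f := ⟨a, ha⟩
  refine (ht f hf).trans ?_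
  exact eq_of_local hg Y h V _ _ (hf.choose_spec.trans ha.symm)

theorem exists_ext {A₁ A₂ : Scheme.{u}ᵒᵖ ⥤ Type u} {g : A₁ ⟶ A₂}
    (hg : IsLocalIsomorphism g) (Y : Scheme.{u}) (h : A₁ ⟶ yoneda.obj Y) :
    ∃ k : A₂ ⟶ yoneda.obj Y, g ≫ k = h := by
  choose t ht using exists_section hg Y h
  refine ⟨{ app := fun S => TypeCat.ofHom (t S.unop), naturality := ?_ }, ?_⟩
  · rintro ⟨S⟩ ⟨S'⟩ ⟨p⟩
    change S' ⟶ S at p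
    ext b
    change t S' (A₂.map p.op b) = (yoneda.obj Y).map p.op (t S b)
    refine ((yon_sheaf Y) _ (img_mem hg S' (A₂.map p.op b))).isSeparatedFor.ext ?_
    rintro V f ⟨a, ha⟩
    rw [ht S' _ V f a ha, ← ConcreteCategory.comp_apply, ← Functor.map_comp, ← op_comp]
    refine (ht S b V (f ≫ p) a ?_).symm
    rw [op_comp, A₂.map_comp, ConcreteCategory.comp_apply]
    exact ha
  · ext ⟨S⟩ a
    have := ht S (g.app _ a) S (𝟙 S) a (by simp)
    simpa using this

/-- Given a local isomorphism `g : A₁ ⟶ A₂` and compatible natural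
transformations `ψ₁ = ψ₂ ∘ g` to the functor of points of a scheme `M₀`,
`ψ₁` corepresents `A₁` if and only if `ψ₂` corepresents `A₂`. -/
theorem corepresents_iff_of_local_isomorphism
    {A₁ A₂ : Scheme.{u}ᵒᵖ ⥤ Type u} (g : A₁ ⟶ A₂)
    (hg : IsLocalIsomorphism g) (M₀ : Scheme.{u})
    (ψ₁ : A₁ ⟶ yoneda.obj M₀) (ψ₂ : A₂ ⟶ yoneda.obj M₀)
    (hfac : ψ₁ = g ≫ ψ₂) :
    Corepresents ψ₁ ↔ Corepresents ψ₂ := by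
  subst hfac
  constructor
  · intro H Y h
    obtain ⟨σ, hσ, hu⟩ := H Y (g ≫ h)
    refine ⟨σ, hom_ext_of_local hg Y _ _ (by simpa using hσ), fun τ hτ => hu τ ?_⟩
    simp only [hτ, Category.assoc]
  · intro H Y h
    obtain ⟨k, rfl⟩ := exists_ext hg Y h
    obtain ⟨σ, hσ, hu⟩ := H Y k
    refine ⟨σ, by simp only [hσ, Category.assoc], fun τ hτ => hu τ ?_⟩
    exact hom_ext_of_local hg Y _ _ (by simpa using hτ)
end

section
/- Let p and q be polynomials with rational coefficients, both with positive leading coefficients, and suppose deg q < deg p. Then p ≺ q in the Rudakov ordering: there exists n₀ such that for every integer n ≥ n₀ there exists m₀ such that for every integer m ≥ m₀ one has p(n) · q(m) < q(n) · p(m). (A polynomial of lower degree is strictly bigger in this ordering.) -/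
open Polynomial

lemma eventually_pos_aux (r : Polynomial ℚ) (hr : 0 < r.leadingCoeff) :
    ∃ n₀ : ℕ, ∀ n : ℕ, n₀ ≤ n → 0 < r.eval (n : ℚ) := by
  by_cases h : 0 < r.degree
  · have h1 := (r.tendsto_atTop_of_leadingCoeff_nonneg h hr.le).comp
      (tendsto_natCast_atTop_atTop (R := ℚ))
    exact Filter.eventually_atTop.1 (h1.eventually_gt_atTop 0)
  · have h2 := Polynomial.eq_C_of_degree_le_zero (not_lt.1 h)
    rw [h2, leadingCoeff_C] at hr
    refine ⟨0, fun n _ => ?_⟩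
    rw [h2, eval_C]
    exact hr

/-- In the Rudakov ordering on polynomials with positive leading coefficients,
a polynomial of lower degree is strictly bigger: if `deg q < deg p` then
`p ≺ q`, i.e. `p(n) q(m) < q(n) p(m)` for `m ≫ n ≫ 0`. -/
theorem lower_degree_bigger_in_rudakov_ordering
    (p q : Polynomial ℚ)
    (hp : 0 < p.leadingCoeff) (hq : 0 < q.leadingCoeff)
    (hdeg : q.degree < p.degree) :
    ∃ n₀ : ℕ, ∀ n : ℕ, n₀ ≤ n →
      ∃ m₀ : ℕ, ∀ m : ℕ, m₀ ≤ m →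
        p.eval (n : ℚ) * q.eval (m : ℚ) < q.eval (n : ℚ) * p.eval (m : ℚ) := by
  obtain ⟨n₀, hn₀⟩ := eventually_pos_aux q hq
  refine ⟨n₀, fun n hn => ?_⟩
  have hqn := hn₀ n hn
  have hd : (C (p.eval (n : ℚ)) * q).degree < (C (q.eval (n : ℚ)) * p).degree := by
    rw [degree_C_mul hqn.ne']
    rw [C_mul']
    exact (degree_smul_le _ _).trans_lt hdeg
  obtain ⟨m₀, hm₀⟩ := eventually_pos_aux
    (C (q.eval (n : ℚ)) * p - C (p.eval (n : ℚ)) * q) (by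
      rw [leadingCoeff_sub_of_degree_lt hd, leadingCoeff_mul, leadingCoeff_C]
      exact mul_pos hqn hp)
  refine ⟨m₀, fun m hm => ?_⟩
  have := hm₀ m hm
  simp only [eval_sub, eval_mul, eval_C] at this
  linarith
end
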